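/- arXiv:1501.04697 — 10 statements merged into one kernel-verified Lean document; each statement's English description precedes it below -/
import Mathlib

section
/- Let R be a ring and let A and B be square matrices over R that are shift equivalent over R. Then there exists a nilpotent square matrix N over R such that B is strong shift equivalent over R to the block diagonal matrix A ⊕ N = [[A, 0], [0, N]]. -/
/-- All entries of the matrix `A` lie in the subset `S`. -/
def entriesIn {R : Type*} {m n : ℕ} (S : Set R) (A : Matrix (Fin m) (Fin n) R) : Prop :=
  ∀ i j, A i j ∈ S

/-- Elementary strong shift equivalence over the subset `S`. -/
def IsESSE {R : Type*} [Semiring R] (S : Set R) {m n : ℕ}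
    (A : Matrix (Fin m) (Fin m) R) (B : Matrix (Fin n) (Fin n) R) : Prop :=
  ∃ (U : Matrix (Fin m) (Fin n) R) (V : Matrix (Fin n) (Fin m) R),
    entriesIn S U ∧ entriesIn S V ∧ A = U * V ∧ B = V * U

/-- Strong shift equivalence over `S`: a chain of elementary strong shift equivalences. -/
def IsSSE {R : Type*} [Semiring R] (S : Set R) {m n : ℕ}
    (A : Matrix (Fin m) (Fin m) R) (B : Matrix (Fin n) (Fin n) R) : Prop :=
  Relation.TransGen (fun X Y : Σ k, Matrix (Fin k) (Fin k) R => IsESSE S X.2 Y.2) ⟨m, A⟩ ⟨n, B⟩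

/-- Shift equivalence over `S` with lag `l`. -/
def IsSE {R : Type*} [Semiring R] (S : Set R) {m n : ℕ}
    (A : Matrix (Fin m) (Fin m) R) (B : Matrix (Fin n) (Fin n) R) (l : ℕ) : Prop :=
  ∃ (U : Matrix (Fin m) (Fin n) R) (V : Matrix (Fin n) (Fin m) R),
    entriesIn S U ∧ entriesIn S V ∧
    A ^ l = U * V ∧ B ^ l = V * U ∧ A * U = U * B ∧ B * V = V * A



/-- Strong shift equivalence for matrices indexed by arbitrary finite types. -/
def GSSE {R : Type*} [Ring R] {ι κ : Type} (A : Matrix ι ι R) (B : Matrix κ κ R) : Prop :=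
  ∀ (a b : ℕ) (e : ι ≃ Fin a) (f : κ ≃ Fin b),
    IsSSE (Set.univ : Set R) (Matrix.reindex e e A) (Matrix.reindex f f B)

theorem GSSE.trans {R : Type*} [Ring R] {ι κ τ : Type} [Fintype κ]
    {A : Matrix ι ι R} {B : Matrix κ κ R} {C : Matrix τ τ R}
    (h₁ : GSSE A B) (h₂ : GSSE B C) : GSSE A C := by
  intro a b e f
  have h1 := h₁ a _ e (Fintype.equivFin κ)
  have h2 := h₂ _ b (Fintype.equivFin κ) f
  exact Relation.TransGen.trans h1 h2

theorem GSSE.of_mul {R : Type*} [Ring R] {ι κ : Type} [Fintype ι] [Fintype κ]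
    (P : Matrix ι κ R) (Q : Matrix κ ι R) : GSSE (P * Q) (Q * P) := by
  intro a b e f
  refine Relation.TransGen.single ⟨Matrix.reindex e f P, Matrix.reindex f e Q,
    fun _ _ => trivial, fun _ _ => trivial, ?_, ?_⟩
  · simp [Matrix.submatrix_mul_equiv]
  · simp [Matrix.submatrix_mul_equiv]

theorem GSSE.of_eq {R : Type*} [Ring R] {ι κ : Type} [Fintype ι] [Fintype κ]
    {A : Matrix ι ι R} {B : Matrix κ κ R}
    (P : Matrix ι κ R) (Q : Matrix κ ι R) (h1 : A = P * Q) (h2 : B = Q * P) : GSSE A B := by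
  subst h1 h2
  exact GSSE.of_mul P Q

/-- The off-diagonal block next to a nilpotent block can be removed. -/
theorem GSSE.kill {R : Type*} [Ring R] {μ ι : Type} [Fintype μ] [Fintype ι]
    [DecidableEq μ] [DecidableEq ι] (A : Matrix μ μ R) (N : Matrix ι ι R) (X : Matrix μ ι R)
    (k : ℕ) : GSSE (Matrix.fromBlocks A X 0 N) (Matrix.fromBlocks A (X * N ^ k) 0 N) := by
  induction k with
  | zero =>
    refine GSSE.of_eq 1 (Matrix.fromBlocks A X 0 N) ?_ ?_ <;> simp
  | succ k ih =>
    refine ih.trans (GSSE.of_eq (Matrix.fromBlocks 1 0 0 N)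
      (Matrix.fromBlocks A (X * N ^ k) 0 1) ?_ ?_)
    · simp [Matrix.fromBlocks_multiply]
    · simp [Matrix.fromBlocks_multiply, pow_succ, Matrix.mul_assoc]

theorem gsse_main {R : Type*} [Ring R] {μ : Type} [Fintype μ] [DecidableEq μ]
    (A : Matrix μ μ R) (l : ℕ) : ∀ (ι : Type) [Fintype ι] [DecidableEq ι]
    (B : Matrix ι ι R) (U W : Matrix μ ι R) (V : Matrix ι μ R) (k : ℕ),
    U * V = A ^ (l + 1) → B * V = V * A → B ^ k = V * W →
    ∃ (κ : Type) (_ : Fintype κ) (_ : DecidableEq κ) (N : Matrix κ κ R),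
      IsNilpotent N ∧ GSSE B (Matrix.fromBlocks A 0 0 N) := by
  induction l with
  | zero =>
    intro ι _ _ B U W V k hUV hBV hW
    have hUV' : U * V = A := by simpa using hUV
    have hNV : (B - V * U) * V = 0 := by
      rw [Matrix.sub_mul, hBV, Matrix.mul_assoc, hUV', sub_self]
    have hpow : ∀ j, (B - V * U) ^ (j + 1) = (B - V * U) * B ^ j := by
      intro j
      induction j with
      | zero => simp
      | succ j ih =>
        have h2 : (B - V * U) * (B - V * U) = (B - V * U) * B := by
          rw [Matrix.mul_sub (B - V * U) B (V * U), ← Matrix.mul_assoc, hNV]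
          simp
        rw [pow_succ', ih, ← mul_assoc, h2, mul_assoc, ← pow_succ']
    have hnil : (B - V * U) ^ (k + 1) = 0 := by
      rw [hpow, hW, ← Matrix.mul_assoc, hNV, Matrix.zero_mul]
    refine ⟨ι, inferInstance, inferInstance, B - V * U, ⟨k + 1, hnil⟩, ?_⟩
    have h1 : GSSE B (Matrix.fromBlocks A U 0 (B - V * U)) := by
      refine GSSE.of_eq (Matrix.fromCols V 1) (Matrix.fromRows U (B - V * U)) ?_ ?_
      · simp [Matrix.fromCols_mul_fromRows]
      · rw [Matrix.fromRows_mul_fromCols, hUV', hNV]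
        simp
    have h2 := GSSE.kill A (B - V * U) U (k + 1)
    rw [hnil, Matrix.mul_zero] at h2
    exact h1.trans h2
  | succ l ih =>
    intro ι _ _ B U W V k hUV hBV hW
    have hpow : ∀ j, (Matrix.fromBlocks B 0 U 0 : Matrix (ι ⊕ μ) (ι ⊕ μ) R) ^ (j + 1)
        = Matrix.fromBlocks (B ^ (j + 1)) 0 (U * B ^ j) 0 := by
      intro j
      induction j with
      | zero => simp
      | succ j ih' =>
        rw [pow_succ, ih', Matrix.fromBlocks_multiply]
        simp [pow_succ, Matrix.mul_assoc]
    obtain ⟨κ, i1, i2, N, hN, hS⟩ := ih (ι ⊕ μ) (Matrix.fromBlocks B 0 U 0)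
      (Matrix.fromCols 0 1) (Matrix.fromCols (A * W) 0)
      (Matrix.fromRows V (A ^ (l + 1))) (k + 1)
      (by simp [Matrix.fromCols_mul_fromRows])
      (by
        rw [Matrix.fromBlocks_mul_fromRows, Matrix.fromRows_mul, hBV, hUV]
        simp [pow_succ])
      (by
        rw [hpow, Matrix.fromRows_mul_fromCols, pow_succ', hW, ← Matrix.mul_assoc B, hBV,
          ← Matrix.mul_assoc U, hUV]
        simp [pow_succ, Matrix.mul_assoc])
    refine ⟨κ, i1, i2, N, hN, GSSE.trans ?_ hS⟩
    refine GSSE.of_eq (Matrix.fromCols 1 0) (Matrix.fromRows B U) ?_ ?_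
    · simp [Matrix.fromCols_mul_fromRows]
    · rw [Matrix.fromRows_mul_fromCols]
      simp

/-- If the square matrices `A` and `B` over a ring `R` are shift equivalent over `R`,
then there is a nilpotent matrix `N` over `R` such that `B` is strong shift equivalent
over `R` to the block diagonal matrix `A ⊕ N`. -/
theorem sse_to_blockDiag_nilpotent_of_se {R : Type*} [Ring R] {m n : ℕ}
    {A : Matrix (Fin m) (Fin m) R} {B : Matrix (Fin n) (Fin n) R}
    (h : ∃ l : ℕ, 1 ≤ l ∧ IsSE (Set.univ : Set R) A B l) :
    ∃ (p : ℕ) (N : Matrix (Fin p) (Fin p) R), IsNilpotent N ∧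
      IsSSE (Set.univ : Set R) B
        (Matrix.reindex finSumFinEquiv finSumFinEquiv (Matrix.fromBlocks A 0 0 N)) := by
  obtain ⟨l, hl, U, V, -, -, hA, hB, hAU, hBV⟩ := h
  obtain ⟨l, rfl⟩ : ∃ l', l = l' + 1 := ⟨l - 1, by omega⟩
  obtain ⟨κ, i1, i2, N, ⟨k, hk⟩, hS⟩ := gsse_main A l (Fin n) B U U V (l + 1) hA.symm hBV hB
  let g := Fintype.equivFin κ
  refine ⟨Fintype.card κ, Matrix.reindex g g N, ⟨k, ?_⟩, ?_⟩
  · have := map_pow (Matrix.reindexAlgEquiv ℕ R g) N k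
    rw [hk, map_zero] at this
    exact this.symm
  · have := hS n _ (Equiv.refl _) ((Equiv.sumCongr (Equiv.refl (Fin m)) g).trans finSumFinEquiv)
    have heq : Matrix.reindex ((Equiv.sumCongr (Equiv.refl (Fin m)) g).trans finSumFinEquiv)
        ((Equiv.sumCongr (Equiv.refl (Fin m)) g).trans finSumFinEquiv)
        (Matrix.fromBlocks A 0 0 N) = Matrix.reindex finSumFinEquiv finSumFinEquiv
        (Matrix.fromBlocks A 0 0 (Matrix.reindex g g N)) := by
      ext i j
      obtain ⟨i, rfl⟩ := finSumFinEquiv.surjective i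
      obtain ⟨j, rfl⟩ := finSumFinEquiv.surjective j
      rcases i with i | i <;> rcases j with j | j <;> simp
    rw [heq] at this
    exact this
end

section
/- Let R be a semiring and let A and B be square matrices over R. If A and B are strong shift equivalent over R with lag ℓ, then A and B are shift equivalent over R with lag ℓ. -/
/-- Strong shift equivalence over `S` with lag `l`: a chain of `l` elementary
strong shift equivalences from the first matrix to the second. -/
def SSELag {R : Type*} [Semiring R] (S : Set R) :
    ℕ → (Σ k, Matrix (Fin k) (Fin k) R) → (Σ k, Matrix (Fin k) (Fin k) R) → Prop
  | 0, X, Y => X = Y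
  | l + 1, X, Y => ∃ Z, IsESSE S X.2 Z.2 ∧ SSELag S l Z Y

theorem mul_pow_swap {R : Type*} [Semiring R] {m n : ℕ}
    (U : Matrix (Fin m) (Fin n) R) (V : Matrix (Fin n) (Fin m) R) (l : ℕ) :
    U * (V * U) ^ l = (U * V) ^ l * U := by
  induction l with
  | zero => simp
  | succ k ih =>
    rw [pow_succ, ← Matrix.mul_assoc, ih, pow_succ]
    simp only [Matrix.mul_assoc]

theorem se_of_sse_aux {R : Type*} [Semiring R] (l : ℕ) :
    ∀ X Y : (Σ k, Matrix (Fin k) (Fin k) R), SSELag (Set.univ : Set R) l X Y →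
      IsSE (Set.univ : Set R) X.2 Y.2 l := by
  induction l with
  | zero =>
    intro X Y h
    have h' : X = Y := h
    subst h'
    exact ⟨1, 1, fun _ _ => trivial, fun _ _ => trivial, by simp, by simp, by simp, by simp⟩
  | succ l ih =>
    rintro ⟨a, A⟩ ⟨b, B⟩ ⟨⟨c, C⟩, ⟨U, V, -, -, hA, hC⟩, h⟩
    obtain ⟨P, Q, -, -, h1, h2, h3, h4⟩ := ih _ _ h
    dsimp only at *
    refine ⟨U * P, Q * V, fun _ _ => trivial, fun _ _ => trivial, ?_, ?_, ?_, ?_⟩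
    · calc A ^ (l + 1) = (U * V) ^ l * U * V := by rw [hA, pow_succ, Matrix.mul_assoc]
        _ = U * C ^ l * V := by rw [← mul_pow_swap, hC]
        _ = _ := by rw [h1]; simp only [Matrix.mul_assoc]
    · calc B ^ (l + 1) = Q * (P * B) := by rw [pow_succ, h2, Matrix.mul_assoc]
        _ = _ := by rw [← h3, hC]; simp only [Matrix.mul_assoc]
    · calc A * (U * P) = U * (C * P) := by rw [hA, hC]; simp only [Matrix.mul_assoc]
        _ = _ := by rw [h3, Matrix.mul_assoc]
    · calc B * (Q * V) = Q * C * V := by rw [← Matrix.mul_assoc, h4]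
        _ = _ := by rw [hA, hC]; simp only [Matrix.mul_assoc]

/-- Strong shift equivalence over a semiring `R` with lag `l` implies shift
equivalence over `R` with lag `l`. -/
theorem se_of_sse_lag {R : Type*} [Semiring R] {m n : ℕ}
    {A : Matrix (Fin m) (Fin m) R} {B : Matrix (Fin n) (Fin n) R}
    {l : ℕ} (hl : 1 ≤ l)
    (h : SSELag (Set.univ : Set R) l ⟨m, A⟩ ⟨n, B⟩) :
    IsSE (Set.univ : Set R) A B l := by
  exact se_of_sse_aux l _ _ h
end

section
/- Let R be a commutative ring and let A be an n×n matrix over R. Then the R[t]-module cokernel of the map R[t]ⁿ → R[t]ⁿ given by v ↦ (I − tA)v is isomorphic, as an R[t]-module, to the direct limit module G_A. -/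
noncomputable section

/-- The maps of the direct system `Rⁿ → Rⁿ → ⋯` in which each map is `x ↦ A x`:
the map from level `i` to level `j` is `x ↦ A^(j-i) x`. -/
def limApp {R : Type*} [CommRing R] {n : ℕ} (A : Matrix (Fin n) (Fin n) R)
    (i j : ℕ) (_ : i ≤ j) : (Fin n → R) →ₗ[R] (Fin n → R) :=
  Matrix.mulVecLin (A ^ (j - i))

instance limApp_directedSystem {R : Type*} [CommRing R] {n : ℕ}
    (A : Matrix (Fin n) (Fin n) R) :
    DirectedSystem (fun _ : ℕ => Fin n → R) (fun i j h => limApp A i j h) where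
  map_self i x := by simp [limApp]
  map_map {k j i} hij hjk x := by
    have h : A ^ (k - j) * A ^ (j - i) = A ^ (k - i) := by
      rw [← pow_add]; congr 1; omega
    simp only [limApp]
    rw [← h, Matrix.mulVecLin_mul]
    rfl

/-- `G_A`: the direct limit of the system `Rⁿ → Rⁿ → ⋯`, `x ↦ A x`. -/
abbrev GA {R : Type*} [CommRing R] {n : ℕ} (A : Matrix (Fin n) (Fin n) R) : Type _ :=
  Module.DirectLimit (fun _ : ℕ => Fin n → R) (limApp A)

/-- The action of `t` on `G_A`, given by `t • [x, k] = [x, k + 1]`. -/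
def shiftMap {R : Type*} [CommRing R] {n : ℕ} (A : Matrix (Fin n) (Fin n) R) :
    GA A →ₗ[R] GA A :=
  Module.DirectLimit.lift R ℕ (fun _ : ℕ => Fin n → R) (limApp A)
    (fun i => Module.DirectLimit.of R ℕ (fun _ : ℕ => Fin n → R) (limApp A) (i + 1))
    (by
      intro i j hij x
      have h : limApp A i j hij x = limApp A (i + 1) (j + 1) (by omega) x := by
        simp [limApp, Nat.succ_sub_succ]
      rw [h]
      exact Module.DirectLimit.of_f)

/-- Constant vectors. -/
def cvec (R : Type*) [CommRing R] (n : ℕ) : (Fin n → R) →ₗ[R] (Fin n → Polynomial R) :=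
  LinearMap.compLeft (Algebra.linearMap R (Polynomial R)) (Fin n)

lemma cvec_apply {R : Type*} [CommRing R] {n : ℕ} (x : Fin n → R) (i : Fin n) :
    cvec R n x i = Polynomial.C (x i) := rfl

lemma cvec_single {R : Type*} [CommRing R] {n : ℕ} (i : Fin n) :
    cvec R n (Pi.single i 1) = Pi.single i 1 := by
  ext1 j
  rw [cvec_apply]
  by_cases h : j = i
  · subst h; simp
  · simp [h]

/-- The matrix `I - tA`. -/
abbrev matB {R : Type*} [CommRing R] {n : ℕ} (A : Matrix (Fin n) (Fin n) R) :
    Matrix (Fin n) (Fin n) (Polynomial R) :=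
  (1 : Matrix (Fin n) (Fin n) (Polynomial R)) - (Polynomial.X : Polynomial R) • A.map Polynomial.C

lemma matB_cvec {R : Type*} [CommRing R] {n : ℕ} (A : Matrix (Fin n) (Fin n) R)
    (x : Fin n → R) :
    Matrix.mulVecLin (matB A) (cvec R n x) =
      cvec R n x - (Polynomial.X : Polynomial R) • cvec R n (A.mulVec x) := by
  rw [Matrix.mulVecLin_apply, Matrix.sub_mulVec, Matrix.one_mulVec, Matrix.smul_mulVec]
  congr 2
  ext1 i
  simp [cvec_apply, Matrix.mulVec, dotProduct]

/-- The structure maps into the direct limit. -/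
abbrev gaOf {R : Type*} [CommRing R] {n : ℕ} (A : Matrix (Fin n) (Fin n) R) (i : ℕ) :
    (Fin n → R) →ₗ[R] GA A :=
  Module.DirectLimit.of R ℕ (fun _ : ℕ => Fin n → R) (limApp A) i

lemma shiftMap_gaOf {R : Type*} [CommRing R] {n : ℕ} (A : Matrix (Fin n) (Fin n) R) (i : ℕ)
    (x : Fin n → R) : shiftMap A (gaOf A i x) = gaOf A (i + 1) x :=
  Module.DirectLimit.lift_of ..

lemma gaOf_succ {R : Type*} [CommRing R] {n : ℕ} (A : Matrix (Fin n) (Fin n) R) (i : ℕ)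
    (x : Fin n → R) : gaOf A (i + 1) (A.mulVec x) = gaOf A i x := by
  have h : A.mulVec x = limApp A i (i + 1) (by omega) x := by simp [limApp]
  rw [h]
  exact Module.DirectLimit.of_f

/-- The forward map. -/
def fwd {R : Type*} [CommRing R] {n : ℕ} (A : Matrix (Fin n) (Fin n) R) :
    (Fin n → Polynomial R) →ₗ[Polynomial R] Module.AEval' (shiftMap A) :=
  (Pi.basisFun (Polynomial R) (Fin n)).constr (Polynomial R)
    (fun i => Module.AEval'.of (shiftMap A) (gaOf A 0 (Pi.single i 1)))

lemma fwd_cvec {R : Type*} [CommRing R] {n : ℕ} (A : Matrix (Fin n) (Fin n) R)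
    (x : Fin n → R) : fwd A (cvec R n x) = Module.AEval'.of (shiftMap A) (gaOf A 0 x) := by
  have h : (fwd A).restrictScalars R ∘ₗ cvec R n =
      (Module.AEval'.of (shiftMap A)).toLinearMap ∘ₗ gaOf A 0 := by
    refine (Pi.basisFun R (Fin n)).ext fun i => ?_
    simp only [Pi.basisFun_apply, LinearMap.comp_apply, LinearMap.restrictScalars_apply,
      cvec_single, LinearEquiv.coe_coe]
    rw [← Pi.basisFun_apply (Polynomial R), fwd, Module.Basis.constr_basis]
  exact LinearMap.congr_fun h x

lemma X_pow_fwd_cvec {R : Type*} [CommRing R] {n : ℕ} (A : Matrix (Fin n) (Fin n) R)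
    (k : ℕ) (x : Fin n → R) :
    fwd A ((Polynomial.X : Polynomial R) ^ k • cvec R n x) =
      Module.AEval'.of (shiftMap A) (gaOf A k x) := by
  induction k with
  | zero => rw [pow_zero, one_smul, fwd_cvec]
  | succ k ih =>
    rw [pow_succ', mul_smul, map_smul, ih, Module.AEval.X_smul_of, ← shiftMap_gaOf]
    rfl

lemma fwd_range {R : Type*} [CommRing R] {n : ℕ} (A : Matrix (Fin n) (Fin n) R) :
    LinearMap.range (Matrix.mulVecLin (matB A)) ≤ LinearMap.ker (fwd A) := by
  rw [LinearMap.range_le_ker_iff]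
  refine (Pi.basisFun (Polynomial R) (Fin n)).ext fun i => ?_
  rw [Pi.basisFun_apply, LinearMap.comp_apply, ← cvec_single, matB_cvec, map_sub, fwd_cvec,
    ← pow_one Polynomial.X, X_pow_fwd_cvec, gaOf_succ, sub_self, LinearMap.zero_apply]

/-- The cokernel. -/
abbrev Cok {R : Type*} [CommRing R] {n : ℕ} (A : Matrix (Fin n) (Fin n) R) : Type _ :=
  (Fin n → Polynomial R) ⧸ LinearMap.range (Matrix.mulVecLin (matB A))

/-- The class of `t ^ k x`. -/
def bwdAt {R : Type*} [CommRing R] {n : ℕ} (A : Matrix (Fin n) (Fin n) R) (k : ℕ) :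
    (Fin n → R) →ₗ[R] Cok A :=
  ((Submodule.mkQ (LinearMap.range (Matrix.mulVecLin (matB A)))).restrictScalars R ∘ₗ
    (LinearMap.lsmul (Polynomial R) (Fin n → Polynomial R)
      (Polynomial.X ^ k)).restrictScalars R) ∘ₗ cvec R n

lemma bwdAt_apply {R : Type*} [CommRing R] {n : ℕ} (A : Matrix (Fin n) (Fin n) R) (k : ℕ)
    (x : Fin n → R) : bwdAt A k x =
      Submodule.mkQ (LinearMap.range (Matrix.mulVecLin (matB A)))
        ((Polynomial.X : Polynomial R) ^ k • cvec R n x) := rfl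

lemma bwdAt_succ {R : Type*} [CommRing R] {n : ℕ} (A : Matrix (Fin n) (Fin n) R) (k : ℕ)
    (x : Fin n → R) : bwdAt A (k + 1) (A.mulVec x) = bwdAt A k x := by
  rw [bwdAt_apply, bwdAt_apply, eq_comm, ← sub_eq_zero, ← map_sub, Submodule.mkQ_apply,
    Submodule.Quotient.mk_eq_zero]
  refine ⟨(Polynomial.X : Polynomial R) ^ k • cvec R n x, ?_⟩
  rw [map_smul, matB_cvec, smul_sub, smul_smul, pow_succ]

lemma bwdAt_pow {R : Type*} [CommRing R] {n : ℕ} (A : Matrix (Fin n) (Fin n) R) (k d : ℕ)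
    (x : Fin n → R) : bwdAt A (k + d) ((A ^ d).mulVec x) = bwdAt A k x := by
  induction d with
  | zero => simp
  | succ d ih => rw [pow_succ', ← Matrix.mulVec_mulVec, ← add_assoc, bwdAt_succ, ih]

/-- The backward map on the limit. -/
def bwd {R : Type*} [CommRing R] {n : ℕ} (A : Matrix (Fin n) (Fin n) R) :
    GA A →ₗ[R] Cok A :=
  Module.DirectLimit.lift R ℕ (fun _ : ℕ => Fin n → R) (limApp A) (bwdAt A) (by
    intro i j hij x
    obtain ⟨d, rfl⟩ := Nat.exists_eq_add_of_le hij
    simpa [limApp] using bwdAt_pow A i d x)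

lemma bwd_gaOf {R : Type*} [CommRing R] {n : ℕ} (A : Matrix (Fin n) (Fin n) R) (k : ℕ)
    (x : Fin n → R) : bwd A (gaOf A k x) = bwdAt A k x :=
  Module.DirectLimit.lift_of ..

lemma bwd_shift {R : Type*} [CommRing R] {n : ℕ} (A : Matrix (Fin n) (Fin n) R) (m : GA A) :
    bwd A (shiftMap A • m) = (Polynomial.X : Polynomial R) • bwd A m := by
  induction m using Module.DirectLimit.induction_on with
  | _ i x =>
    change bwd A (shiftMap A (gaOf A i x)) = Polynomial.X • bwd A (gaOf A i x)
    rw [shiftMap_gaOf, bwd_gaOf, bwd_gaOf, bwdAt_apply, bwdAt_apply, pow_succ', mul_smul,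
      map_smul]

/-- The backward map. -/
def bwdX {R : Type*} [CommRing R] {n : ℕ} (A : Matrix (Fin n) (Fin n) R) :
    Module.AEval' (shiftMap A) →ₗ[Polynomial R] Cok A :=
  LinearMap.ofAEval (shiftMap A) (bwd A) (bwd_shift A)

lemma bwdX_of {R : Type*} [CommRing R] {n : ℕ} (A : Matrix (Fin n) (Fin n) R) (m : GA A) :
    bwdX A (Module.AEval'.of (shiftMap A) m) = bwd A m := rfl

lemma exists_lift {R : Type*} [CommRing R] {n : ℕ} (A : Matrix (Fin n) (Fin n) R)
    (m : Module.AEval' (shiftMap A)) : ∃ v : Fin n → Polynomial R, fwd A v = m ∧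
      bwdX A m = Submodule.mkQ (LinearMap.range (Matrix.mulVecLin (matB A))) v := by
  obtain ⟨m, rfl⟩ := (Module.AEval'.of (shiftMap A)).surjective m
  induction m using Module.DirectLimit.induction_on with
  | _ i x => exact ⟨_, X_pow_fwd_cvec A i x, by rw [bwdX_of, bwd_gaOf, bwdAt_apply]⟩

lemma bwdX_injective {R : Type*} [CommRing R] {n : ℕ} (A : Matrix (Fin n) (Fin n) R) :
    Function.Injective (bwdX A) := by
  intro m m' h
  obtain ⟨u, rfl, hu⟩ := exists_lift A m
  obtain ⟨v, rfl, hv⟩ := exists_lift A m'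
  rw [hu, hv, Submodule.mkQ_apply, Submodule.mkQ_apply, Submodule.Quotient.eq] at h
  have h2 : fwd A (u - v) = 0 := fwd_range A h
  have h3 : fwd A u = fwd A (u - v) + fwd A v := by rw [← map_add, sub_add_cancel]
  rw [h3, h2, zero_add]

lemma bwdX_surjective {R : Type*} [CommRing R] {n : ℕ} (A : Matrix (Fin n) (Fin n) R) :
    Function.Surjective (bwdX A) := by
  have h : bwdX A ∘ₗ fwd A = Submodule.mkQ (LinearMap.range (Matrix.mulVecLin (matB A))) := by
    refine (Pi.basisFun (Polynomial R) (Fin n)).ext fun i => ?_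
    rw [Pi.basisFun_apply, ← cvec_single, LinearMap.comp_apply, fwd_cvec, bwdX_of, bwd_gaOf,
      bwdAt_apply, pow_zero, one_smul]
  intro q
  obtain ⟨v, rfl⟩ := Submodule.mkQ_surjective _ q
  exact ⟨fwd A v, LinearMap.congr_fun h v⟩

/-- For an `n × n` matrix `A` over a commutative ring `R`, the cokernel of the map
`R[t]ⁿ → R[t]ⁿ`, `v ↦ (I - tA) v`, is isomorphic as an `R[t]`-module to the direct
limit `G_A` (with `t` acting on `G_A` by `t • [x, k] = [x, k + 1]`). -/
theorem cokernel_I_sub_tA_iso_GA {R : Type*} [CommRing R] {n : ℕ}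
    (A : Matrix (Fin n) (Fin n) R) :
    Nonempty
      (((Fin n → Polynomial R) ⧸
          LinearMap.range (Matrix.mulVecLin
            ((1 : Matrix (Fin n) (Fin n) (Polynomial R)) -
              (Polynomial.X : Polynomial R) • A.map Polynomial.C)))
        ≃ₗ[Polynomial R] Module.AEval' (shiftMap A)) := by
  exact ⟨(LinearEquiv.ofBijective (bwdX A) ⟨bwdX_injective A, bwdX_surjective A⟩).symm⟩

end
end

section
/- Let R be a dense subring of ℝ and let A be a square matrix over R with trace(A) > 0. If A is strong shift equivalent over ℝ to a primitive real matrix, then A is strong shift equivalent over R to a primitive matrix with entries in R. -/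
/-- A square real matrix is primitive if it is entrywise nonnegative and some
power of it is entrywise strictly positive. -/
def IsPrimitive {n : ℕ} (A : Matrix (Fin n) (Fin n) ℝ) : Prop :=
  (∀ i j, 0 ≤ A i j) ∧ ∃ k : ℕ, 0 < k ∧ ∀ i j, 0 < (A ^ k) i j

namespace SSEProof

open Matrix Filter Topology

/-- Similarity of real matrices with possibly different index types. -/
def Sim {ι κ : Type} [Fintype ι] [DecidableEq ι] [Fintype κ] [DecidableEq κ]
    (M : Matrix ι ι ℝ) (N : Matrix κ κ ℝ) : Prop :=
  ∃ (G : Matrix κ ι ℝ) (G' : Matrix ι κ ℝ), G * G' = 1 ∧ G' * G = 1 ∧ N = G * M * G'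

section
variable {ι κ μ : Type} [Fintype ι] [DecidableEq ι] [Fintype κ] [DecidableEq κ]
  [Fintype μ] [DecidableEq μ]

theorem Sim.symm {M : Matrix ι ι ℝ} {N : Matrix κ κ ℝ} (h : Sim M N) : Sim N M := by
  obtain ⟨G, G', h1, h2, rfl⟩ := h
  refine ⟨G', G, h2, h1, ?_⟩
  calc M = (G' * G) * M * (G' * G) := by rw [h2]; simp
    _ = _ := by simp only [Matrix.mul_assoc]

theorem Sim.trans {M : Matrix ι ι ℝ} {N : Matrix κ κ ℝ} {K : Matrix μ μ ℝ}
    (h : Sim M N) (h' : Sim N K) : Sim M K := by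
  obtain ⟨G, G', h1, h2, rfl⟩ := h
  obtain ⟨H, H', k1, k2, rfl⟩ := h'
  refine ⟨H * G, G' * H', ?_, ?_, ?_⟩
  · calc H * G * (G' * H') = H * (G * G') * H' := by simp only [Matrix.mul_assoc]
      _ = 1 := by rw [h1]; simpa using k1
  · calc G' * H' * (H * G) = G' * (H' * H) * G := by simp only [Matrix.mul_assoc]
      _ = 1 := by rw [k2]; simpa using h2
  · simp only [Matrix.mul_assoc]

theorem Sim.refl (M : Matrix ι ι ℝ) : Sim M M := ⟨1, 1, by simp, by simp, by simp⟩

theorem Sim.submatrix (M : Matrix ι ι ℝ) (e : κ ≃ ι) : Sim M (M.submatrix e e) := by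
  refine ⟨(1 : Matrix ι ι ℝ).submatrix e id, (1 : Matrix ι ι ℝ).submatrix id e, ?_, ?_, ?_⟩
  · ext i j
    simp [Matrix.mul_apply, Matrix.one_apply]
  · rw [Matrix.submatrix_mul_equiv]
    simp
  · ext i j
    simp [Matrix.mul_apply, Matrix.one_apply]

end

/-- `Ext k M`: after `k` lower zero extensions, `M` becomes similar to a positive matrix. -/
def Ext : ℕ → ∀ {ι : Type} [Fintype ι] [DecidableEq ι], Matrix ι ι ℝ → Prop
  | 0, _, _, _, M => ∃ (κ : Type) (_ : Fintype κ) (_ : DecidableEq κ) (N : Matrix κ κ ℝ),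
      Nonempty κ ∧ Sim M N ∧ ∀ i j, 0 < N i j
  | k + 1, ι, _, _, M => ∃ (κ : Type) (_ : Fintype κ) (_ : DecidableEq κ) (X : Matrix κ ι ℝ),
      Ext k (Matrix.fromBlocks M 0 X 0)

theorem Ext.sim (k : ℕ) : ∀ {ι κ : Type} [Fintype ι] [DecidableEq ι] [Fintype κ] [DecidableEq κ]
    {M : Matrix ι ι ℝ} {N : Matrix κ κ ℝ}, Ext k M → Sim M N → Ext k N := by
  induction k with
  | zero =>
    intro ι κ _ _ _ _ M N h hs
    obtain ⟨μ, i1, i2, K, hne, hK, hp⟩ := h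
    exact ⟨μ, i1, i2, K, hne, hs.symm.trans hK, hp⟩
  | succ k ih =>
    intro ι κ _ _ _ _ M N h hs
    obtain ⟨μ, i1, i2, X, hX⟩ := h
    obtain ⟨G, G', h1, h2, rfl⟩ := hs
    refine ⟨μ, i1, i2, X * G', ih hX ?_⟩
    refine ⟨fromBlocks G 0 0 1, fromBlocks G' 0 0 1, ?_, ?_, ?_⟩
    · simp [fromBlocks_multiply, h1]
    · simp [fromBlocks_multiply, h2]
    · simp [fromBlocks_multiply]

section
variable {ι κ : Type} [Fintype ι] [DecidableEq ι] [Fintype κ] [DecidableEq κ]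

theorem eventually_pos {X : Type} [TopologicalSpace X] {f : X → Matrix ι κ ℝ} (hf : Continuous f)
    (x : X) (h : ∀ i j, 0 < f x i j) : ∀ᶠ y in 𝓝 x, ∀ i j, 0 < f y i j := by
  rw [Filter.eventually_all]; intro i
  rw [Filter.eventually_all]; intro j
  exact (hf.matrix_elem i j).continuousAt.eventually (lt_mem_nhds (h i j))

theorem exists_small {f : ℝ → Matrix ι κ ℝ} (hf : Continuous f)
    (h : ∀ i j, 0 < f 0 i j) : ∃ t : ℝ, 0 < t ∧ ∀ i j, 0 < f t i j := by
  have h1 : ∀ᶠ y in 𝓝[>] (0 : ℝ), ∀ i j, 0 < f y i j :=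
    (eventually_pos hf 0 h).filter_mono nhdsWithin_le_nhds
  obtain ⟨t, ht, ht'⟩ := (h1.and self_mem_nhdsWithin).exists
  exact ⟨t, ht', ht⟩

theorem simPos_upper [Nonempty ι] (M : Matrix ι ι ℝ) (hM : ∀ i j, 0 < M i j) (W : Matrix ι κ ℝ) :
    ∃ N : Matrix (ι ⊕ κ) (ι ⊕ κ) ℝ, Sim (fromBlocks M W 0 0) N ∧ ∀ i j, 0 < N i j := by
  let R : Matrix κ ι ℝ := Matrix.of fun _ _ => 1
  let Q : Matrix ι κ ℝ := Matrix.of fun _ _ => 1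
  obtain ⟨s, hs, hs'⟩ : ∃ s : ℝ, 0 < s ∧ ∀ i j, 0 < (M - s • (Q * (R * M))) i j := by
    apply exists_small (f := fun s => M - s • (Q * (R * M)))
    · fun_prop
    · simpa using hM
  let a : ℝ → Matrix ι ι ℝ := fun δ => M - δ • (W * R)
  let b : ℝ → Matrix ι κ ℝ := fun δ => δ • W
  let c : ℝ → Matrix κ ι ℝ := fun δ => R * M - δ • (R * W * R)
  let d : ℝ → Matrix κ κ ℝ := fun δ => δ • (R * W)
  let F : ℝ → Matrix (ι ⊕ κ) (ι ⊕ κ) ℝ := fun δ =>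
    fromBlocks (a δ - s • (Q * c δ)) ((a δ - s • (Q * c δ)) * (s • Q) + (b δ - s • (Q * d δ)))
      (c δ) (c δ * (s • Q) + d δ)
  have hF : Continuous F := by
    apply Continuous.matrix_fromBlocks <;> fun_prop
  have hRM : ∀ i j, 0 < (R * M) i j := by
    intro i j
    rw [Matrix.mul_apply]
    exact Finset.sum_pos (fun x _ => by simpa [R] using hM x j) Finset.univ_nonempty
  obtain ⟨δ, hδ, hδ'⟩ := exists_small hF (by
    have hq : ∀ {τ : Type} (Y : Matrix τ ι ℝ) (_ : ∀ i j, 0 < Y i j) i j, 0 < (Y * (s • Q)) i j := by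
      intro τ Y hY i j
      rw [Matrix.mul_apply]
      exact Finset.sum_pos (fun x _ => by simpa [Q] using mul_pos (hY i x) hs) Finset.univ_nonempty
    rintro (i | i) (j | j)
    · simpa [F, a, c] using hs' i j
    · simpa [F, a, b, c, d] using hq _ hs' i j
    · simpa [F, c] using hRM i j
    · simpa [F, c, d] using hq _ hRM i j)
  refine ⟨F δ, ?_, hδ'⟩
  have s1 : Sim (fromBlocks M W 0 (0 : Matrix κ κ ℝ)) (fromBlocks M (b δ) 0 (0 : Matrix κ κ ℝ)) := by
    refine ⟨fromBlocks 1 0 0 (δ⁻¹ • 1), fromBlocks 1 0 0 (δ • 1), ?_, ?_, ?_⟩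
    · simp [fromBlocks_multiply, smul_smul, hδ.ne']
    · simp [fromBlocks_multiply, smul_smul, hδ.ne']
    · simp [fromBlocks_multiply, b]
  have s2 : Sim (fromBlocks M (b δ) 0 (0 : Matrix κ κ ℝ)) (fromBlocks (a δ) (b δ) (c δ) (d δ)) := by
    refine ⟨fromBlocks 1 0 R 1, fromBlocks 1 0 (-R) 1, ?_, ?_, ?_⟩
    · simp [fromBlocks_multiply]
    · simp [fromBlocks_multiply]
    · simp [fromBlocks_multiply, a, b, c, d, sub_eq_add_neg]
  have s3 : Sim (fromBlocks (a δ) (b δ) (c δ) (d δ)) (F δ) := by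
    refine ⟨fromBlocks 1 (-(s • Q)) 0 1, fromBlocks 1 (s • Q) 0 1, ?_, ?_, ?_⟩
    · simp [fromBlocks_multiply]
    · simp [fromBlocks_multiply]
    · simp [fromBlocks_multiply, F, sub_eq_add_neg]
  exact s1.trans (s2.trans s3)

end

theorem Ext.upper (k : ℕ) : ∀ {ι κ : Type} [Fintype ι] [DecidableEq ι] [Fintype κ] [DecidableEq κ]
    {M : Matrix ι ι ℝ} (V : Matrix ι κ ℝ), Ext k M → Ext k (fromBlocks M V 0 (0 : Matrix κ κ ℝ)) := by
  induction k with
  | zero =>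
    intro ι κ _ _ _ _ M V h
    obtain ⟨μ, i1, i2, K, hne, ⟨G, G', h1, h2, rfl⟩, hp⟩ := h
    obtain ⟨N, hN, hN'⟩ := simPos_upper _ hp (G * V)
    refine ⟨μ ⊕ κ, inferInstance, inferInstance, N, inferInstance, ?_, hN'⟩
    refine Sim.trans ?_ hN
    refine ⟨fromBlocks G 0 0 1, fromBlocks G' 0 0 1, ?_, ?_, ?_⟩
    · simp [fromBlocks_multiply, h1]
    · simp [fromBlocks_multiply, h2]
    · simp [fromBlocks_multiply]
  | succ k ih =>
    intro ι κ _ _ _ _ M V h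
    obtain ⟨μ, i1, i2, X, hX⟩ := h
    have h1 := ih (fromRows V (0 : Matrix μ κ ℝ)) hX
    refine ⟨μ, i1, i2, fromCols X 0, h1.sim k ?_⟩
    let e : (ι ⊕ κ) ⊕ μ ≃ (ι ⊕ μ) ⊕ κ :=
      { toFun := fun x => match x with
          | .inl (.inl i) => .inl (.inl i)
          | .inl (.inr i) => .inr i
          | .inr i => .inl (.inr i)
        invFun := fun x => match x with
          | .inl (.inl i) => .inl (.inl i)
          | .inr i => .inl (.inr i)
          | .inl (.inr i) => .inr i
        left_inv := by rintro ((_ | _) | _) <;> rfl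
        right_inv := by rintro ((_ | _) | _) <;> rfl }
    convert Sim.submatrix _ e using 1
    ext ((i | i) | i) ((j | j) | j) <;> simp [e]

theorem Ext.esse (k : ℕ) {ι κ : Type} [Fintype ι] [DecidableEq ι] [Fintype κ] [DecidableEq κ]
    (U : Matrix ι κ ℝ) (V : Matrix κ ι ℝ) (h : Ext k (V * U)) : Ext (k + 1) (U * V) := by
  refine ⟨κ, inferInstance, inferInstance, V, (Ext.upper k V h).sim k ?_⟩
  refine ⟨fromBlocks U 1 1 0, fromBlocks 0 1 1 (-U), ?_, ?_, ?_⟩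
  · simp [fromBlocks_multiply]
  · simp [fromBlocks_multiply]
  · simp [fromBlocks_multiply, Matrix.mul_assoc]

theorem Ext.of_isSSE {m n : ℕ} {A : Matrix (Fin m) (Fin m) ℝ} {B : Matrix (Fin n) (Fin n) ℝ}
    (h : IsSSE (Set.univ : Set ℝ) A B) (hB : ∃ k, Ext k B) : ∃ k, Ext k A := by
  have key : ∀ X Y : Σ k, Matrix (Fin k) (Fin k) ℝ, Relation.TransGen
      (fun X Y : Σ k, Matrix (Fin k) (Fin k) ℝ => IsESSE (Set.univ : Set ℝ) X.2 Y.2) X Y →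
      (∃ k, Ext k Y.2) → ∃ k, Ext k X.2 := by
    intro X Y hXY
    induction hXY using Relation.TransGen.head_induction_on with
    | single h1 =>
      rintro ⟨k, hk⟩
      obtain ⟨U, V, -, -, e1, e2⟩ := h1
      rw [e2] at hk
      rw [e1]
      exact ⟨_, hk.esse k⟩
    | head h1 _ ih =>
      intro hY
      obtain ⟨k, hk⟩ := ih hY
      obtain ⟨U, V, -, -, e1, e2⟩ := h1
      rw [e2] at hk
      rw [e1]
      exact ⟨_, hk.esse k⟩
  exact key ⟨m, A⟩ ⟨n, B⟩ h hB

theorem trace_eq_of_isSSE {m n : ℕ} {A : Matrix (Fin m) (Fin m) ℝ} {B : Matrix (Fin n) (Fin n) ℝ}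
    (h : IsSSE (Set.univ : Set ℝ) A B) : A.trace = B.trace := by
  have key : ∀ X Y : Σ k, Matrix (Fin k) (Fin k) ℝ, Relation.TransGen
      (fun X Y : Σ k, Matrix (Fin k) (Fin k) ℝ => IsESSE (Set.univ : Set ℝ) X.2 Y.2) X Y →
      X.2.trace = Y.2.trace := by
    intro X Y hXY
    induction hXY with
    | single h1 =>
      obtain ⟨U, V, -, -, e1, e2⟩ := h1
      rw [e1, e2, Matrix.trace_mul_comm]
    | tail _ h1 ih =>
      obtain ⟨U, V, -, -, e1, e2⟩ := h1
      rw [ih, e1, e2, Matrix.trace_mul_comm]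
  exact key ⟨m, A⟩ ⟨n, B⟩ h


theorem exists_crossing {α : Type} {r : α → α → Prop} {Q : α → Prop} {a b : α}
    (h : Relation.ReflTransGen r a b) (ha : ¬ Q a) (hb : Q b) : ∃ x y, r x y ∧ ¬ Q x ∧ Q y := by
  induction h with
  | refl => exact absurd hb ha
  | @tail c d _ h1 ih =>
    by_cases hc : Q c
    · exact ih hc
    · exact ⟨c, d, h1, hc, hb⟩

/-- The support graph of `B` is strongly connected. -/
def Irr {ι : Type} (B : Matrix ι ι ℝ) : Prop :=
  ∀ i j, Relation.ReflTransGen (fun a b => 0 < B a b) i j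

theorem simPos_of_full_col {ι : Type} [Fintype ι] [DecidableEq ι] (N : ℕ) :
    ∀ (B : Matrix ι ι ℝ), (∀ i j, 0 ≤ B i j) → Irr B → (o : ι) → (∀ i, 0 < B i o) →
      (Set.ncard {j | ∃ i, B i j = 0} = N) → Ext 0 B := by
  induction N using Nat.strong_induction_on with
  | _ N ih =>
  intro B hB hirr o ho hN
  by_cases hall : ∀ j, ∀ i, B i j ≠ 0
  · exact ⟨ι, inferInstance, inferInstance, B, ⟨o⟩, Sim.refl B,
      fun i j => lt_of_le_of_ne (hB i j) (hall j i).symm⟩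
  push Not at hall
  obtain ⟨j0, hj0⟩ := hall
  obtain ⟨l, k, hlk, hl, hk⟩ := exists_crossing (Q := fun j => ∃ i, B i j = 0) (hirr o j0)
    (by rintro ⟨i, hi⟩; exact (ho i).ne' hi) hj0
  have hl : ∀ i, 0 < B i l := fun i => lt_of_le_of_ne (hB i l) (fun h => hl ⟨i, h.symm⟩)
  have hkl : k ≠ l := by
    rintro rfl
    obtain ⟨i, hi⟩ := hk
    exact (hl i).ne' hi
  let E : Matrix ι ι ℝ := Matrix.of fun i j => if j = l ∧ i ≠ l then 1 else 0
  have hEE : E * E = 0 := by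
    ext i j
    rw [Matrix.mul_apply]
    apply Finset.sum_eq_zero
    intro x _
    by_cases hx : x = l <;> simp [E, hx]
  let F : ℝ → Matrix ι ι ℝ := fun t => (1 + t • E) * B * (1 - t • E)
  have hFcol : ∀ t i j, j ≠ l → F t i j = B i j + (if i ≠ l then t * B l j else 0) := by
    intro t i j hj
    have h1 : ((1 + t • E) * B * E) i j = 0 := by
      rw [Matrix.mul_apply]
      apply Finset.sum_eq_zero
      intro x _
      simp [E, hj]
    have h2 : (E * B) i j = if i ≠ l then B l j else 0 := by
      rw [Matrix.mul_apply, Finset.sum_eq_single l]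
      · by_cases hi : i = l <;> simp [E, hi]
      · intro b _ hb
        simp [E, hb]
      · simp
    have h3 : F t = B + t • (E * B) - t • ((1 + t • E) * B * E) := by
      simp only [F, Matrix.mul_sub, Matrix.add_mul, Matrix.mul_one, Matrix.one_mul,
        Matrix.mul_smul, Matrix.smul_mul]
    rw [h3]
    simp only [Matrix.sub_apply, Matrix.add_apply, Matrix.smul_apply, h1, h2]
    by_cases hi : i = l <;> simp [hi]
  obtain ⟨t, ht, htp⟩ : ∃ t : ℝ, 0 < t ∧ ∀ i (_ : Unit), 0 < (F t).submatrix id (fun _ => l) i () := by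
    have := exists_small (ι := ι) (κ := Unit) (f := fun t => (F t).submatrix id (fun _ : Unit => l))
      (by
        apply Continuous.matrix_submatrix
        fun_prop) (by intro i j; simpa [F] using hl i)
    obtain ⟨t, h1, h2⟩ := this
    exact ⟨t, h1, fun i _ => h2 i ()⟩
  have htp : ∀ i, 0 < F t i l := fun i => htp i ()
  have hmono : ∀ i j, 0 < B i j → 0 < F t i j := by
    intro i j hij
    by_cases hj : j = l
    · rw [hj]; exact htp i
    · rw [hFcol t i j hj]
      have := mul_nonneg ht.le (hB l j)
      split_ifs <;> linarith
  have hnn : ∀ i j, 0 ≤ F t i j := by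
    intro i j
    by_cases hj : j = l
    · rw [hj]; exact (htp i).le
    · rw [hFcol t i j hj]
      have := mul_nonneg ht.le (hB l j)
      have := hB i j
      split_ifs <;> linarith
  have hsim : Sim (F t) B := by
    refine Sim.symm ⟨1 + t • E, 1 - t • E, ?_, ?_, rfl⟩ <;>
    simp [Matrix.mul_sub, Matrix.add_mul, Matrix.sub_mul, Matrix.mul_add, hEE]
  refine Ext.sim 0 (ih _ ?_ (F t) hnn ?_ l htp rfl) hsim
  · rw [← hN]
    apply Set.ncard_lt_ncard _ (Set.toFinite _)
    refine ⟨?_, ?_⟩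
    · rintro j ⟨i, hi⟩
      exact ⟨i, by_contra fun h => (hmono i j (lt_of_le_of_ne (hB i j) (Ne.symm h))).ne' hi⟩
    · intro h
      obtain ⟨i, hi⟩ := h hk
      rw [hFcol t i k hkl] at hi
      have h1 := hB i k
      have h2 := mul_pos ht hlk
      split_ifs at hi with h3
      · linarith
      · push Not at h3
        rw [h3] at hi
        linarith
  · intro i j
    exact Relation.ReflTransGen.mono hmono _ _ (hirr i j)

theorem ext_of_loop (N : ℕ) : ∀ {ι : Type} [Fintype ι] [DecidableEq ι]
    (B : Matrix ι ι ℝ), (∀ i j, 0 ≤ B i j) → Irr B → (o : ι) → 0 < B o o →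
      (Set.ncard {i | B i o = 0} = N) → ∃ k, Ext k B := by
  induction N using Nat.strong_induction_on with
  | _ N ih =>
  intro ι _ _ B hB hirr o ho hN
  by_cases hall : ∀ i, B i o ≠ 0
  · exact ⟨0, simPos_of_full_col _ B hB hirr o
      (fun i => lt_of_le_of_ne (hB i o) (hall i).symm) rfl⟩
  push Not at hall
  obtain ⟨i0, hi0⟩ := hall
  obtain ⟨a, w, haw, ha, hw⟩ := exists_crossing (Q := fun j => 0 < B j o) (hirr i0 o)
    (by rw [hi0]; exact lt_irrefl _) ho
  have ha : B a o = 0 := le_antisymm (not_lt.1 ha) (hB a o)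
  let Y : Matrix ι Unit ℝ := Matrix.of fun i _ => B i o
  let X : Matrix Unit ι ℝ := Matrix.of fun _ j => if j = o then 1 / 2 else 0
  let C : Matrix (ι ⊕ Unit) (ι ⊕ Unit) ℝ :=
    fromBlocks (B - Y * X) ((B - Y * X) * Y) X (X * Y)
  have c11 : ∀ i j, C (.inl i) (.inl j) = if j = o then B i j / 2 else B i j := by
    intro i j
    by_cases hj : j = o
    · simp [C, Matrix.mul_apply, X, Y, hj]; ring
    · simp [C, Matrix.mul_apply, X, Y, hj]
  have c12 : ∀ i, C (.inl i) (.inr ()) = (∑ x, B i x * B x o) - B i o / 2 * B o o := by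
    intro i
    simp [-mul_eq_mul_right_iff, C, Matrix.mul_apply, X, Y, sub_mul, Finset.sum_sub_distrib]
    try ring
  have c21 : ∀ j, C (.inr ()) (.inl j) = if j = o then 1 / 2 else 0 := fun j => rfl
  have c22 : C (.inr ()) (.inr ()) = B o o / 2 := by
    simp [C, Matrix.mul_apply, X, Y]; ring
  have hsum : ∀ i x, B i x * B x o ≤ ∑ x, B i x * B x o := fun i x =>
    Finset.single_le_sum (f := fun x => B i x * B x o)
      (fun y _ => mul_nonneg (hB i y) (hB y o)) (Finset.mem_univ x)
  have c12' : ∀ i x, B i x * B x o ≤ 2 * C (.inl i) (.inr ()) := by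
    intro i x
    rw [c12]
    have h1 := hsum i x
    have h2 := hsum i o
    linarith
  have hC : ∀ i j, 0 ≤ C i j := by
    rintro (i | ⟨⟩) (j | ⟨⟩)
    · rw [c11]
      have := hB i j
      split_ifs <;> linarith
    · have := c12' i o
      have := mul_nonneg (hB i o) (hB o o)
      linarith
    · rw [c21]; split_ifs <;> norm_num
    · rw [c22]; linarith
  have hmono : ∀ i j, 0 < B i j → 0 < C (.inl i) (.inl j) := by
    intro i j h
    rw [c11]; split_ifs <;> linarith
  have hold : ∀ i j, Relation.ReflTransGen (fun a b => 0 < C a b) (Sum.inl i) (Sum.inl j) :=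
    fun i j => (hirr i j).lift Sum.inl hmono
  have hqo : Relation.ReflTransGen (fun a b => 0 < C a b) (Sum.inr ()) (Sum.inl o) :=
    Relation.ReflTransGen.single (by rw [c21]; norm_num)
  have hoq : Relation.ReflTransGen (fun a b => 0 < C a b) (Sum.inl o) (Sum.inr ()) :=
    Relation.ReflTransGen.single (by
      have := c12' o o
      have := mul_pos ho ho
      linarith)
  have hCirr : Irr C := by
    rintro (i | ⟨⟩) (j | ⟨⟩)
    · exact hold i j
    · exact (hold i o).trans hoq
    · exact hqo.trans (hold o j)
    · exact Relation.ReflTransGen.refl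
  obtain ⟨k, hk⟩ := ih (Set.ncard {i | C i (Sum.inr ()) = 0}) (by
      rw [← hN, ← Set.ncard_image_of_injective {i | B i o = 0} (Sum.inl_injective (β := Unit))]
      apply Set.ncard_lt_ncard _ (Set.toFinite _)
      refine ⟨?_, ?_⟩
      · rintro (i | ⟨⟩) hi
        · refine ⟨i, ?_, rfl⟩
          have h1 := c12' i o
          have hi : C (.inl i) (.inr ()) = 0 := hi
          rw [hi] at h1
          by_contra h
          have := mul_pos (lt_of_le_of_ne (hB i o) (Ne.symm h)) ho
          linarith
        · have hi : C (.inr ()) (.inr ()) = 0 := hi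
          rw [c22] at hi
          linarith
      · intro h
        have h2 : C (.inl a) (.inr ()) = 0 := h ⟨a, ha, rfl⟩
        have h1 := c12' a w
        have := mul_pos haw hw
        linarith) C hC hCirr (.inr ()) (by rw [c22]; linarith) rfl
  refine ⟨k + 1, Unit, inferInstance, inferInstance, X, hk.sim k ?_⟩
  refine Sim.symm ⟨fromBlocks 1 (-Y) 0 1, fromBlocks 1 Y 0 1, ?_, ?_, ?_⟩
  · simp [fromBlocks_multiply]
  · simp [fromBlocks_multiply]
  · simp [fromBlocks_multiply, C, sub_eq_add_neg]

theorem irr_of_primitive {n : ℕ} {B : Matrix (Fin n) (Fin n) ℝ} (h : _root_.IsPrimitive B) : Irr B := by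
  obtain ⟨h0, k, -, hk⟩ := h
  have key : ∀ k i j, 0 < (B ^ k) i j → Relation.ReflTransGen (fun a b => 0 < B a b) i j := by
    intro k
    induction k with
    | zero =>
      intro i j h
      by_cases hij : i = j
      · rw [hij]
      · simp [Matrix.one_apply, hij] at h
    | succ k ih =>
      intro i j h
      rw [pow_succ, Matrix.mul_apply] at h
      obtain ⟨x, -, hx⟩ := Finset.exists_lt_of_sum_lt (f := fun _ => (0 : ℝ)) (by simpa using h)
      have h1 : 0 < B x j := lt_of_le_of_ne (h0 x j) (by intro h; rw [← h] at hx; simp at hx)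
      exact (ih i x (pos_of_mul_pos_left hx (h0 x j))).tail h1
  exact fun i j => key k i j (hk i j)

theorem ext_of_primitive {n : ℕ} {B : Matrix (Fin n) (Fin n) ℝ} (h : _root_.IsPrimitive B)
    (ht : 0 < B.trace) : ∃ k, Ext k B := by
  obtain ⟨o, -, ho⟩ := Finset.exists_lt_of_sum_lt (s := Finset.univ) (f := fun _ : Fin n => (0 : ℝ))
    (g := fun i => B i i) (by simpa [Matrix.trace] using ht)
  exact ext_of_loop _ B h.1 (irr_of_primitive h) o ho rfl


/-- `M` is strong shift equivalent over `S` to a positive matrix over `S`. -/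
def Target (S : Subring ℝ) {ι : Type} [Fintype ι] (M : Matrix ι ι ℝ) : Prop :=
  ∃ (q : ℕ) (C : Matrix (Fin q) (Fin q) ℝ), entriesIn (S : Set ℝ) C ∧ (∀ i j, 0 < C i j) ∧
    ∀ (n : ℕ) (e : ι ≃ Fin n), IsSSE (S : Set ℝ) (M.submatrix e.symm e.symm) C

section
variable {ι κ : Type} [Fintype ι] [DecidableEq ι] [Fintype κ] [DecidableEq κ] (S : Subring ℝ)

theorem esse_submatrix {U : Matrix ι κ ℝ} {V : Matrix κ ι ℝ} (hU : ∀ i j, U i j ∈ S)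
    (hV : ∀ i j, V i j ∈ S) {m n : ℕ} (e : ι ≃ Fin m) (f : κ ≃ Fin n) :
    IsESSE (S : Set ℝ) ((U * V).submatrix e.symm e.symm) ((V * U).submatrix f.symm f.symm) :=
  ⟨U.submatrix e.symm f.symm, V.submatrix f.symm e.symm, fun _ _ => hU _ _, fun _ _ => hV _ _,
    by rw [Matrix.submatrix_mul_equiv], by rw [Matrix.submatrix_mul_equiv]⟩

theorem Target.esse {U : Matrix ι κ ℝ} {V : Matrix κ ι ℝ} (hU : ∀ i j, U i j ∈ S)
    (hV : ∀ i j, V i j ∈ S) (h : Target S (V * U)) : Target S (U * V) := by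
  obtain ⟨q, C, h1, h2, h3⟩ := h
  refine ⟨q, C, h1, h2, fun n e => ?_⟩
  have h4 := h3 _ (Fintype.equivFin κ)
  have h5 := esse_submatrix S hU hV e (Fintype.equivFin κ)
  unfold IsSSE at h4 ⊢
  exact Relation.TransGen.head h5 h4

theorem one_mem_entries (i j : ι) : (1 : Matrix ι ι ℝ) i j ∈ S := by
  rw [Matrix.one_apply]; split_ifs
  · exact S.one_mem
  · exact S.zero_mem

theorem mul_mem_entries {α β γ : Type} [Fintype β] {U : Matrix α β ℝ} {V : Matrix β γ ℝ}
    (hU : ∀ i j, U i j ∈ S) (hV : ∀ i j, V i j ∈ S) (i : α) (j : γ) : (U * V) i j ∈ S := by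
  rw [Matrix.mul_apply]
  exact S.sum_mem fun x _ => S.mul_mem (hU _ _) (hV _ _)

theorem Target.of_pos {M : Matrix ι ι ℝ} (hM : ∀ i j, M i j ∈ S) (hp : ∀ i j, 0 < M i j) :
    Target S M := by
  refine ⟨_, M.submatrix (Fintype.equivFin ι).symm (Fintype.equivFin ι).symm,
    fun _ _ => hM _ _, fun _ _ => hp _ _, fun n e => ?_⟩
  have h := esse_submatrix S hM (one_mem_entries S) e (Fintype.equivFin ι)
  rw [Matrix.mul_one, Matrix.one_mul] at h
  exact Relation.TransGen.single h

theorem Target.conj {H : Matrix κ ι ℝ} {H' : Matrix ι κ ℝ} (hH : ∀ i j, H i j ∈ S)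
    (hH' : ∀ i j, H' i j ∈ S) (h1 : H' * H = 1) {M : Matrix ι ι ℝ} (hM : ∀ i j, M i j ∈ S)
    (h : Target S (H * M * H')) : Target S M := by
  have h2 : Target S ((M * H') * H) :=
    Target.esse S (mul_mem_entries S hM hH') hH (by rwa [← Matrix.mul_assoc])
  rwa [Matrix.mul_assoc, h1, Matrix.mul_one] at h2

/-- All matrices over `S` close to `M` are SSE over `S` to a positive matrix. -/
def Good (M : Matrix ι ι ℝ) : Prop := ∀ᶠ M' in 𝓝 M, (∀ i j, M' i j ∈ S) → Target S M'

theorem Good.of_pos {M : Matrix ι ι ℝ} (hp : ∀ i j, 0 < M i j) : Good S M := by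
  filter_upwards [eventually_pos continuous_id M hp] with M' h hM'
  exact Target.of_pos S hM' h

theorem Good.conj {H : Matrix κ ι ℝ} {H' : Matrix ι κ ℝ} (hH : ∀ i j, H i j ∈ S)
    (hH' : ∀ i j, H' i j ∈ S) (h1 : H' * H = 1) {M : Matrix ι ι ℝ}
    (h : Good S (H * M * H')) : Good S M := by
  have hc : Continuous fun M : Matrix ι ι ℝ => H * M * H' := by fun_prop
  filter_upwards [hc.continuousAt.eventually h] with M' h2 hM'
  exact Target.conj S hH hH' h1 hM' (h2 (mul_mem_entries S (mul_mem_entries S hH hM') hH'))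

variable {S}

theorem transvection_mem {i j : ι} {c : ℝ} (hc : c ∈ S) (x y : ι) :
    transvection i j c x y ∈ S := by
  rw [transvection, Matrix.add_apply]
  refine S.add_mem (one_mem_entries S x y) ?_
  rw [Matrix.single_apply]
  split_ifs
  · exact hc
  · exact S.zero_mem

theorem continuous_transvection (i j : ι) : Continuous fun c : ℝ => transvection i j c := by
  apply continuous_matrix
  intro x y
  simp only [transvection, Matrix.add_apply, Matrix.single_apply]
  by_cases h : i = x ∧ j = y
  · simp only [h, and_self, if_true]; fun_prop
  · simp only [h, if_false]; fun_prop

theorem Good.transvection (hS : Dense (S : Set ℝ)) {i j : ι} (hij : i ≠ j) (c : ℝ)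
    {M : Matrix ι ι ℝ}
    (h : Good S (Matrix.transvection i j c * M * Matrix.transvection i j (-c))) : Good S M := by
  have hc : Continuous fun p : Matrix ι ι ℝ × ℝ =>
      Matrix.transvection i j p.2 * p.1 * Matrix.transvection i j (-p.2) := by
    refine Continuous.matrix_mul (Continuous.matrix_mul ?_ continuous_fst) ?_
    · exact (continuous_transvection i j).comp continuous_snd
    · exact (continuous_transvection i j).comp continuous_snd.neg
  have h1 := (hc.continuousAt (x := (M, c))).eventually h
  rw [nhds_prod_eq] at h1
  filter_upwards [h1.curry] with M' h2 hM'
  obtain ⟨c', hc', h3⟩ := (mem_closure_iff_frequently.1 (hS c)).and_eventually h2 |>.exists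
  have h4 := transvection_mem (i := i) (j := j) (S.neg_mem hc')
  have h5 := transvection_mem (i := i) (j := j) hc'
  refine Target.conj S h5 h4 ?_ hM' (h3 (mul_mem_entries S (mul_mem_entries S h5 hM') h4))
  rw [transvection_mul_transvection_same i j hij]
  simp

theorem Good.transvections (hS : Dense (S : Set ℝ)) (L : List (TransvectionStruct ι ℝ)) :
    ∀ (M E' : Matrix ι ι ℝ), (L.map TransvectionStruct.toMatrix).prod * E' = 1 →
      Good S ((L.map TransvectionStruct.toMatrix).prod * M * E') → Good S M := by
  induction L with
  | nil =>
    intro M E' h1 h2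
    simp at h1 h2
    rwa [h1, Matrix.mul_one] at h2
  | cons t L ih =>
    intro M E' h1 h2
    rw [List.map_cons, List.prod_cons] at h1 h2
    set P := (L.map TransvectionStruct.toMatrix).prod with hP
    have h3 : P * (E' * t.toMatrix) = 1 := by
      have : (P * E') * t.toMatrix = 1 := by
        rw [mul_eq_one_comm, ← Matrix.mul_assoc]; exact h1
      rwa [Matrix.mul_assoc] at this
    refine ih M (E' * t.toMatrix) h3 ?_
    obtain ⟨i, j, hij, c⟩ := t
    refine Good.transvection hS hij c ?_
    convert h2 using 1
    simp only [TransvectionStruct.toMatrix_mk, Matrix.mul_assoc]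
    rw [transvection_mul_transvection_same i j hij]
    simp

theorem transvections_mul_diagonal (D : ι → ℝ) (hD : ∀ i, D i ≠ 0)
    (L : List (TransvectionStruct ι ℝ)) : ∃ L' : List (TransvectionStruct ι ℝ),
      (L.map TransvectionStruct.toMatrix).prod * diagonal D =
        diagonal D * (L'.map TransvectionStruct.toMatrix).prod := by
  induction L with
  | nil => exact ⟨[], by simp⟩
  | cons t L ih =>
    obtain ⟨L', hL'⟩ := ih
    obtain ⟨i, j, hij, c⟩ := t
    refine ⟨⟨i, j, hij, (D i)⁻¹ * c * D j⟩ :: L', ?_⟩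
    simp only [List.map_cons, List.prod_cons, TransvectionStruct.toMatrix_mk]
    rw [Matrix.mul_assoc, hL', ← Matrix.mul_assoc, ← Matrix.mul_assoc]
    congr 1
    simp only [Matrix.transvection, Matrix.add_mul, Matrix.mul_add, Matrix.one_mul, Matrix.mul_one]
    congr 1
    ext x y
    simp only [Matrix.mul_diagonal, Matrix.diagonal_mul, Matrix.single_apply]
    by_cases h : i = x ∧ j = y
    · obtain ⟨rfl, rfl⟩ := h
      have := hD i
      simp only [and_self, if_true]
      field_simp
    · simp [h]

theorem Good.of_simPos (hS : Dense (S : Set ℝ)) (M G G' : Matrix ι ι ℝ) (h1 : G * G' = 1)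
    (hp : ∀ i j, 0 < (G * M * G') i j) : Good S M := by
  obtain ⟨L, L', D, hG⟩ := Pivot.exists_list_transvec_mul_diagonal_mul_list_transvec G
  have hdet : G.det ≠ 0 := by
    intro h
    have := congrArg Matrix.det h1
    rw [Matrix.det_mul, h] at this
    simp at this
  have hD : ∀ i, D i ≠ 0 := by
    rw [hG] at hdet
    simp only [Matrix.det_mul, TransvectionStruct.det_toMatrix_prod, Matrix.det_diagonal] at hdet
    simp only [one_mul, mul_one] at hdet
    intro i hi
    exact hdet (Finset.prod_eq_zero (Finset.mem_univ i) hi)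
  obtain ⟨L'', hL''⟩ := transvections_mul_diagonal D hD L
  rw [hL'', Matrix.mul_assoc, ← List.prod_append, ← List.map_append] at hG
  set P := ((L'' ++ L').map TransvectionStruct.toMatrix).prod with hP
  have hE : P * (G' * diagonal D) = 1 := by
    rw [← Matrix.mul_assoc, mul_eq_one_comm, ← Matrix.mul_assoc, ← hG, h1]
  refine Good.transvections hS (L'' ++ L') M (G' * diagonal D) hE ?_
  rw [← hP]
  set K := P * M * (G' * diagonal D) with hK
  have hK' : G * M * G' = diagonal D * K * diagonal (fun i => (D i)⁻¹) := by
    have : diagonal D * diagonal (fun i => (D i)⁻¹) = 1 := by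
      rw [Matrix.diagonal_mul_diagonal]
      simp [hD]
    calc G * M * G' = diagonal D * P * M * G' := by rw [hG]
      _ = diagonal D * P * M * G' * (diagonal D * diagonal (fun i => (D i)⁻¹)) := by
        rw [this, Matrix.mul_one]
      _ = _ := by rw [hK]; simp only [Matrix.mul_assoc]
  let s : ι → ℝ := fun i => if 0 < D i then 1 else -1
  have hs : ∀ i j, diagonal s i j ∈ S := by
    intro i j
    rw [Matrix.diagonal_apply]
    split_ifs
    · simp only [s]; split_ifs
      · exact S.one_mem
      · exact S.neg_mem S.one_mem
    · exact S.zero_mem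
  refine Good.conj S hs hs ?_ (Good.of_pos S ?_)
  · rw [Matrix.diagonal_mul_diagonal, ← Matrix.diagonal_one]
    congr 1
    ext i
    simp only [s]; split_ifs <;> norm_num
  · intro i j
    have h := hp i j
    rw [hK'] at h
    rw [Matrix.mul_diagonal, Matrix.diagonal_mul] at h ⊢
    have e : ∀ i, D i = s i * |D i| := by
      intro i
      simp only [s]; split_ifs with h
      · rw [abs_of_pos h, one_mul]
      · rw [abs_of_nonpos (not_lt.1 h)]; ring
    have e' : (D j)⁻¹ = s j * |D j|⁻¹ := by
      have h2 : (s j)⁻¹ = s j := by simp only [s]; split_ifs <;> norm_num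
      conv_lhs => rw [e j]
      rw [mul_inv, h2]
    rw [e i, e'] at h
    have h3 : s i * |D i| * K i j * (s j * |D j|⁻¹) =
      (s i * K i j * s j) * (|D i| * |D j|⁻¹) := by ring
    rw [h3] at h
    exact pos_of_mul_pos_left h (by positivity)

end

theorem Good.of_ext {S : Subring ℝ} (hS : Dense (S : Set ℝ)) (k : ℕ) :
    ∀ {ι : Type} [Fintype ι] [DecidableEq ι] {M : Matrix ι ι ℝ}, Ext k M → Good S M := by
  induction k with
  | zero =>
    intro ι _ _ M h
    obtain ⟨κ, i1, i2, N, -, ⟨G, G', h1, h2, rfl⟩, hp⟩ := h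
    have hcard : Fintype.card κ = Fintype.card ι := Matrix.square_of_invertible G G' h1 h2
    let e : ι ≃ κ := Fintype.equivOfCardEq hcard.symm
    refine Good.of_simPos hS M (G.submatrix e id) (G'.submatrix id e) ?_ ?_
    · have := congrArg (fun Z => Z.submatrix e e) h1
      simp only [Matrix.submatrix_one_equiv] at this
      rw [← this]
      rfl
    · intro i j
      exact hp (e i) (e j)
  | succ k ih =>
    intro ι _ _ M h
    obtain ⟨κ, i1, i2, X, hX⟩ := h
    have hg := ih hX
    have hc : Continuous fun p : Matrix ι ι ℝ × Matrix κ ι ℝ =>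
        fromBlocks p.1 (0 : Matrix ι κ ℝ) p.2 (0 : Matrix κ κ ℝ) :=
      Continuous.matrix_fromBlocks continuous_fst continuous_const continuous_snd continuous_const
    have h1 := (hc.continuousAt (x := (M, X))).eventually hg
    rw [nhds_prod_eq] at h1
    have hdense : Dense (X := Matrix κ ι ℝ) (Set.pi Set.univ (fun _ : κ => Set.pi Set.univ
        (fun _ : ι => (S : Set ℝ)))) :=
      dense_pi _ fun _ _ => dense_pi _ fun _ _ => hS
    filter_upwards [h1.curry] with M' h2 hM'
    obtain ⟨X', hX', h3⟩ := (mem_closure_iff_frequently.1 (hdense X)).and_eventually h2 |>.exists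
    have hX'' : ∀ i j, X' i j ∈ S := fun i j => hX' i trivial j trivial
    have h4 := h3 (by
      rintro (i | i) (j | j)
      · exact hM' i j
      · exact S.zero_mem
      · exact hX'' i j
      · exact S.zero_mem)
    have h5 : M' = fromCols (1 : Matrix ι ι ℝ) (0 : Matrix ι κ ℝ) * fromRows M' X' := by
      rw [fromCols_mul_fromRows]; simp
    rw [h5]
    refine Target.esse S ?_ ?_ ?_
    · rintro i (j | j)
      · exact one_mem_entries S i j
      · exact S.zero_mem
    · rintro (i | i) j
      · exact hM' i j
      · exact hX'' i j
    · convert h4 using 1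
      rw [fromRows_mul_fromCols]
      simp

end SSEProof

/-- If `R` is a dense subring of `ℝ` and `A` is a matrix over `R` with positive trace
which is strong shift equivalent over `ℝ` to a primitive matrix, then `A` is strong
shift equivalent over `R` to a primitive matrix over `R`. -/
theorem sse_primitive_over_subring_of_sse_primitive_over_real
    (S : Subring ℝ) (hS : Dense (S : Set ℝ)) {n : ℕ}
    {A : Matrix (Fin n) (Fin n) ℝ} (hA : entriesIn (S : Set ℝ) A)
    (htr : 0 < A.trace)
    (h : ∃ (p : ℕ) (B : Matrix (Fin p) (Fin p) ℝ),
      IsPrimitive B ∧ IsSSE (Set.univ : Set ℝ) A B) :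
    ∃ (q : ℕ) (C : Matrix (Fin q) (Fin q) ℝ),
      entriesIn (S : Set ℝ) C ∧ IsPrimitive C ∧ IsSSE (S : Set ℝ) A C := by
  obtain ⟨p, B, hB, hAB⟩ := h
  have hBt : 0 < B.trace := by rwa [← SSEProof.trace_eq_of_isSSE hAB]
  obtain ⟨k, hk⟩ := SSEProof.Ext.of_isSSE hAB (SSEProof.ext_of_primitive hB hBt)
  obtain ⟨q, C, h1, h2, h3⟩ := (SSEProof.Good.of_ext hS k hk).self_of_nhds hA
  refine ⟨q, C, h1, ⟨fun i j => (h2 i j).le, 1, one_pos, fun i j => ?_⟩, ?_⟩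
  · rw [pow_one]
    exact h2 i j
  · exact h3 n (Equiv.refl _)
end

section
/- Let R be a subring of ℝ and let N be a nilpotent square matrix over R all of whose entries are nonnegative. Then N is strong shift equivalent over R to the 1×1 zero matrix (0). -/
/-- A nonnegative nilpotent matrix of positive size has a zero row. -/
theorem exists_zero_row {n : ℕ} (N : Matrix (Fin (n + 1)) (Fin (n + 1)) ℝ)
    (hnil : IsNilpotent N) (hpos : ∀ i j, 0 ≤ N i j) : ∃ i, ∀ j, N i j = 0 := by
  by_contra! hc
  have key : ∀ k : ℕ, (∀ i j, 0 ≤ (N ^ k) i j) ∧ ∀ i, ∃ j, 0 < (N ^ k) i j := by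
    intro k
    induction k with
    | zero =>
      refine ⟨fun i j => ?_, fun i => ⟨i, by simp⟩⟩
      rw [pow_zero, Matrix.one_apply]
      split_ifs <;> simp
    | succ k ih =>
      refine ⟨fun i j => ?_, fun i => ?_⟩
      · rw [pow_succ', Matrix.mul_apply]
        exact Finset.sum_nonneg fun l _ => mul_nonneg (hpos _ _) (ih.1 _ _)
      · obtain ⟨j, hj⟩ := hc i
        obtain ⟨l, hl⟩ := ih.2 j
        refine ⟨l, ?_⟩
        rw [pow_succ', Matrix.mul_apply]
        exact Finset.sum_pos' (fun m _ => mul_nonneg (hpos _ _) (ih.1 _ _))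
          ⟨j, Finset.mem_univ _, mul_pos (lt_of_le_of_ne (hpos _ _) hj.symm) hl⟩
  obtain ⟨k, hk⟩ := hnil
  obtain ⟨j, hj⟩ := (key k).2 0
  rw [hk] at hj
  simp at hj

/-- A nonnegative nilpotent matrix over a subring `R` of `ℝ` is strong shift
equivalent over `R` to the `1 × 1` zero matrix. -/
theorem nonneg_nilpotent_sse_zero (S : Subring ℝ) {n : ℕ}
    (N : Matrix (Fin n) (Fin n) ℝ) (hN : entriesIn (S : Set ℝ) N)
    (hnil : IsNilpotent N) (hpos : ∀ i j, 0 ≤ N i j) :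
    IsSSE (S : Set ℝ) N (0 : Matrix (Fin 1) (Fin 1) ℝ) := by
  induction n with
  | zero =>
    refine Relation.TransGen.single ⟨0, 0, ?_, ?_, ?_, ?_⟩
    · intro i; exact i.elim0
    · intro i j; exact j.elim0
    · ext i; exact i.elim0
    · simp
  | succ n ih =>
    obtain ⟨i, hi⟩ := exists_zero_row N hnil hpos
    set U : Matrix (Fin (n + 1)) (Fin n) ℝ :=
      (1 : Matrix (Fin (n + 1)) (Fin (n + 1)) ℝ).submatrix id i.succAbove with hU
    set V : Matrix (Fin n) (Fin (n + 1)) ℝ := N.submatrix i.succAbove id with hV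
    have hUV : N = U * V := by
      ext a b
      rw [Matrix.mul_apply]
      rcases Fin.eq_self_or_eq_succAbove i a with rfl | ⟨c, rfl⟩
      · simp [hU, hV, hi, (Fin.succAbove_ne _ _).symm]
      · simp [hU, hV, Matrix.one_apply]
    have hVU : N.submatrix i.succAbove i.succAbove = V * U := by
      rw [hU, hV, ← Matrix.submatrix_mul _ _ _ _ _ Function.bijective_id, mul_one]
    have hpow : ∀ k : ℕ, (V * U) ^ (k + 1) = V * (U * V) ^ k * U := by
      intro k
      induction k with
      | zero => simp
      | succ k ihk => rw [pow_succ, ihk, pow_succ (U * V)]; simp only [Matrix.mul_assoc]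
    have hnil' : IsNilpotent (N.submatrix i.succAbove i.succAbove) := by
      obtain ⟨k, hk⟩ := hnil
      refine ⟨k + 1, ?_⟩
      rw [hVU, hpow, ← hUV, hk]
      simp
    have hrest : IsSSE (S : Set ℝ) (N.submatrix i.succAbove i.succAbove)
        (0 : Matrix (Fin 1) (Fin 1) ℝ) :=
      ih _ (fun a b => hN (i.succAbove a) (i.succAbove b)) hnil'
        (fun a b => hpos (i.succAbove a) (i.succAbove b))
    have hstep : IsESSE (S : Set ℝ) N (N.submatrix i.succAbove i.succAbove) := by
      refine ⟨U, V, ?_, ?_, hUV, hVU⟩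
      · intro a b
        rw [hU, Matrix.submatrix_apply, Matrix.one_apply]
        split_ifs
        · exact S.one_mem
        · exact S.zero_mem
      · intro a b
        exact hN _ _
    unfold IsSSE at hrest ⊢
    exact Relation.TransGen.trans (Relation.TransGen.single hstep) hrest
end

section
/- Let R be a dense subring of ℝ and let n be a positive integer. Then SL(n, R), the set of n×n matrices with entries in R and determinant 1, is dense in SL(n, ℝ) (with the topology induced by any norm on the space of n×n real matrices): for every U ∈ SL(n, ℝ) and every δ > 0 there exists V ∈ SL(n, R) with ‖U − V‖∞ < δ. -/
/-- The entrywise sup norm of a real matrix. -/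
noncomputable def matNormInf {m n : ℕ} (M : Matrix (Fin m) (Fin n) ℝ) : ℝ :=
  ⨆ i, ⨆ j, |M i j|

open Matrix in
theorem aux_mul_transvection {n : ℕ} (M : Matrix (Fin n) (Fin n) ℝ) (i j : Fin n) (c : ℝ)
    (a b : Fin n) :
    (M * transvection i j c) a b = M a b + if b = j then c * M a i else 0 := by
  split_ifs with h
  · subst h; simp
  · simp [mul_transvection_apply_of_ne _ _ _ _ h]

open Matrix in
theorem aux_diag {n : ℕ} {i j : Fin n} (hij : i ≠ j) (a : ℝ) (ha : a ≠ 0) :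
    (SpecialLinearGroup.diag2n hij a ha).1 =
      1 * transvection i j a * transvection j i (-a⁻¹) * transvection i j a *
        transvection i j (-1) * transvection j i 1 * transvection i j (-1) := by
  ext k l
  simp only [aux_mul_transvection, SpecialLinearGroup.diag2n_coe, diagonal_apply, one_apply]
  by_cases h1 : l = i
  · subst h1
    by_cases h2 : k = l
    · subst h2; simp [hij, hij.symm, ha]
    · by_cases h3 : k = j
      · subst h3; simp [hij, hij.symm, ha]
      · simp [hij, hij.symm, h2, h3]
  · by_cases h2 : l = j
    · subst h2
      by_cases h3 : k = i
      · subst h3; simp [hij, hij.symm, ha]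
      · by_cases h4 : k = l
        · subst h4; simp [hij, hij.symm, ha]
        · simp [hij, hij.symm, h3, h4]
    · by_cases h3 : k = l
      · subst h3; simp [h1, h2]
      · simp [h1, h2, h3]

open Matrix in
theorem aux_closure (S : Subring ℝ) (hS : Dense (S : Set ℝ))
    {n : ℕ} (U : Matrix (Fin n) (Fin n) ℝ) (hU : U.det = 1) :
    U ∈ closure {V : Matrix (Fin n) (Fin n) ℝ | (∀ i j, V i j ∈ S) ∧ V.det = 1} := by
  set T := {V : Matrix (Fin n) (Fin n) ℝ | (∀ i j, V i j ∈ S) ∧ V.det = 1} with hT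
  have hone : (1 : Matrix (Fin n) (Fin n) ℝ) ∈ T := by
    refine ⟨fun i j => ?_, det_one⟩
    rw [one_apply]; split_ifs
    exacts [S.one_mem, S.zero_mem]
  have hmul : ∀ A B, A ∈ closure T → B ∈ closure T → A * B ∈ closure T := by
    intro A B hA hB
    refine map_mem_closure₂ continuous_mul hA hB ?_
    rintro X ⟨hX, hX'⟩ Y ⟨hY, hY'⟩
    refine ⟨fun i j => ?_, by rw [det_mul, hX', hY', one_mul]⟩
    rw [mul_apply]
    exact S.sum_mem fun k _ => S.mul_mem (hX i k) (hY k j)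
  have htr : ∀ (i j : Fin n) (_ : i ≠ j) (a : ℝ), transvection i j a ∈ closure T := by
    intro i j hij a
    refine map_mem_closure (f := fun a : ℝ => transvection i j a) (s := (S : Set ℝ)) ?_ (hS a) ?_
    · refine continuous_matrix fun k l => ?_
      simp only [transvection, Matrix.add_apply, single_apply]
      split_ifs <;> fun_prop
    · intro b hb
      refine ⟨fun k l => ?_, det_transvection_of_ne i j hij b⟩
      simp only [transvection, Matrix.add_apply, single_apply]
      refine S.add_mem (hone.1 k l) ?_
      split_ifs
      exacts [hb, S.zero_mem]
  rcases subsingleton_or_nontrivial (Fin n) with h | h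
  · have : U = 1 := by
      ext i j
      rw [det_eq_elem_of_subsingleton U i] at hU
      rw [Subsingleton.elim j i, hU, one_apply_eq]
    rw [this]
    exact subset_closure hone
  · refine SpecialLinearGroup.diagonal_transvection_induction'
      (fun M : SpecialLinearGroup (Fin n) ℝ => M.1 ∈ closure T) ⟨U, hU⟩ ?_ ?_ ?_
    · intro i j hij c hc
      rw [aux_diag]
      exact hmul _ _ (hmul _ _ (hmul _ _ (hmul _ _ (hmul _ _ (hmul _ _ (subset_closure hone)
        (htr _ _ hij _)) (htr _ _ hij.symm _)) (htr _ _ hij _)) (htr _ _ hij _))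
        (htr _ _ hij.symm _)) (htr _ _ hij _)
    · intro i j hij a
      exact htr i j hij a
    · intro A B hA hB
      exact hmul _ _ hA hB

/-- If `R` is a dense subring of `ℝ` and `n ≥ 1`, then `SL(n, R)` is dense in
`SL(n, ℝ)`: every determinant-one real matrix can be approximated to within any
`δ > 0` (in the entrywise sup norm) by a determinant-one matrix over `R`. -/
theorem SL_dense_of_dense_subring (S : Subring ℝ) (hS : Dense (S : Set ℝ))
    {n : ℕ} (hn : 0 < n) (U : Matrix (Fin n) (Fin n) ℝ) (hU : U.det = 1)
    {δ : ℝ} (hδ : 0 < δ) :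
    ∃ V : Matrix (Fin n) (Fin n) ℝ,
      (∀ i j, V i j ∈ S) ∧ V.det = 1 ∧ matNormInf (U - V) < δ := by
  have hopen : IsOpen {V : Matrix (Fin n) (Fin n) ℝ | ∀ i j, |U i j - V i j| < δ / 2} := by
    simp only [Set.ofPred_forall]
    refine isOpen_iInter_of_finite fun i => isOpen_iInter_of_finite fun j => ?_
    refine isOpen_lt ?_ continuous_const
    exact (continuous_const.sub (continuous_id.matrix_elem i j)).abs
  obtain ⟨V, hV, hVS, hVd⟩ := mem_closure_iff.1 (aux_closure S hS U hU) _ hopen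
    (by intro i j; simp [hδ])
  refine ⟨V, hVS, hVd, ?_⟩
  have : Nonempty (Fin n) := ⟨⟨0, hn⟩⟩
  refine lt_of_le_of_lt (b := δ / 2) ?_ (by linarith)
  exact ciSup_le fun i => ciSup_le fun j => (hV i j).le
end

section
/- Let R be a dense subring of ℝ, let N be a nilpotent n×n matrix over R, and let δ > 0. Then there exists a matrix V in SL(n, R) such that ‖V⁻¹ N V‖∞ < δ. -/
open Matrix in
/-- Matrices with entries in `S` and determinant one. -/
def slSub (S : Subring ℝ) (n : ℕ) : Submonoid (Matrix (Fin n) (Fin n) ℝ) where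
  carrier := {M | (∀ i j, M i j ∈ S) ∧ M.det = 1}
  mul_mem' := by
    rintro a b ⟨ha, ha'⟩ ⟨hb, hb'⟩
    refine ⟨fun i j => ?_, by rw [Matrix.det_mul, ha', hb', one_mul]⟩
    rw [Matrix.mul_apply]
    exact S.sum_mem fun k _ => S.mul_mem (ha _ _) (hb _ _)
  one_mem' := by
    refine ⟨fun i j => ?_, Matrix.det_one⟩
    rw [Matrix.one_apply]
    split_ifs
    · exact S.one_mem
    · exact S.zero_mem

theorem transvection_mem_closure (S : Subring ℝ) (hS : Dense (S : Set ℝ)) {n : ℕ}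
    (i j : Fin n) (hij : i ≠ j) (c : ℝ) :
    Matrix.transvection i j c ∈ (slSub S n).topologicalClosure := by
  have hc : c ∈ closure (S : Set ℝ) := hS c
  have hcont : Continuous (fun c : ℝ => Matrix.transvection i j c) := by
    unfold Matrix.transvection
    refine continuous_const.add ?_
    refine continuous_matrix fun a b => ?_
    simp only [Matrix.single_apply]
    split_ifs <;> fun_prop
  have h := map_mem_closure hcont hc (t := (slSub S n : Set (Matrix (Fin n) (Fin n) ℝ))) ?_
  · exact h
  · intro x hx
    refine ⟨fun a b => ?_, Matrix.det_transvection_of_ne i j hij x⟩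
    simp only [Matrix.transvection, Matrix.add_apply, Matrix.one_apply, Matrix.single_apply]
    refine S.add_mem ?_ ?_
    · split_ifs
      · exact S.one_mem
      · exact S.zero_mem
    · split_ifs
      · exact hx
      · exact S.zero_mem

theorem weyl_eq {n : ℕ} (i j : Fin n) (hij : i ≠ j) (x : ℝ) (hx : x ≠ 0) :
    Matrix.transvection i j x * Matrix.transvection j i (-x⁻¹) * Matrix.transvection i j x
    = 1 - Matrix.single i i 1 - Matrix.single j j 1 + Matrix.single i j x
      - Matrix.single j i x⁻¹ := by
  simp only [Matrix.transvection, mul_add, add_mul, mul_one, one_mul,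
    Matrix.single_mul_single_same, Matrix.single_mul_single_of_ne _ _ _ _ hij,
    Matrix.single_mul_single_of_ne _ _ _ _ hij.symm]
  have h1 : x * -x⁻¹ = -1 := by field_simp
  have h2 : -x⁻¹ * x = -1 := by field_simp
  have h3 : x * -x⁻¹ * x = -x := by field_simp
  ext a b
  simp only [h1, h2, h3, Matrix.add_apply, Matrix.sub_apply, Matrix.single_apply, Matrix.zero_apply]
  split_ifs <;> ring

theorem diag_eq {n : ℕ} (i j : Fin n) (hij : i ≠ j) (x : ℝ) (hx : x ≠ 0) :
    (1 - Matrix.single i i 1 - Matrix.single j j 1 + Matrix.single i j x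
      - Matrix.single j i x⁻¹) *
    (1 - Matrix.single i i 1 - Matrix.single j j 1 + Matrix.single i j (-1)
      - Matrix.single j i (-1)⁻¹) =
    Matrix.diagonal (Pi.mulSingle i x * Pi.mulSingle j x⁻¹ : Fin n → ℝ) := by
  simp only [mul_add, add_mul, mul_sub, sub_mul, mul_one, one_mul,
    Matrix.single_mul_single_same, Matrix.single_mul_single_of_ne _ _ _ _ hij,
    Matrix.single_mul_single_of_ne _ _ _ _ hij.symm]
  ext a b
  simp only [Matrix.add_apply, Matrix.sub_apply, Matrix.single_apply, Matrix.zero_apply,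
    Matrix.one_apply, Matrix.diagonal_apply, Pi.mul_apply, Pi.mulSingle_apply]
  grind

theorem diagonal_mem_closure (S : Subring ℝ) (hS : Dense (S : Set ℝ)) {n : ℕ}
    (d : Fin n → ℝ) (hd : ∏ i, d i = 1) :
    Matrix.diagonal d ∈ (slSub S n).topologicalClosure := by
  have hne : ∀ i, d i ≠ 0 := by
    intro i h
    rw [Finset.prod_eq_zero (Finset.mem_univ i) h] at hd
    exact zero_ne_one hd
  have key : ∀ (i j : Fin n), i ≠ j → ∀ x : ℝ, x ≠ 0 →
      Matrix.diagonal (Pi.mulSingle i x * Pi.mulSingle j x⁻¹ : Fin n → ℝ) ∈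
        (slSub S n).topologicalClosure := by
    intro i j hij x hx
    rw [← diag_eq i j hij x hx, ← weyl_eq i j hij x hx, ← weyl_eq i j hij (-1) (by norm_num)]
    have t1 := transvection_mem_closure S hS i j hij
    have t2 := transvection_mem_closure S hS j i hij.symm
    exact mul_mem (mul_mem (mul_mem (t1 _) (t2 _)) (t1 _)) (mul_mem (mul_mem (t1 _) (t2 _)) (t1 _))
  rcases n with _ | n
  · rw [Subsingleton.elim (Matrix.diagonal d) 1]
    exact one_mem _
  let K : Submonoid (Fin (n+1) → ℝ) :=
    (slSub S (n+1)).topologicalClosure.comap (Matrix.diagonalRingHom (Fin (n+1)) ℝ).toMonoidHom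
  have hK : ∏ i ∈ Finset.univ.erase (0 : Fin (n+1)),
      (Pi.mulSingle i (d i) * Pi.mulSingle 0 (d i)⁻¹ : Fin (n+1) → ℝ) ∈ K := by
    refine K.prod_mem fun i hi => ?_
    exact key i 0 (Finset.ne_of_mem_erase hi) (d i) (hne i)
  have heq : ∏ i ∈ Finset.univ.erase (0 : Fin (n+1)),
      (Pi.mulSingle i (d i) * Pi.mulSingle 0 (d i)⁻¹ : Fin (n+1) → ℝ) = d := by
    have h0 : d 0 * ∏ i ∈ Finset.univ.erase (0 : Fin (n+1)), d i = 1 := by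
      rw [Finset.mul_prod_erase _ _ (Finset.mem_univ _), hd]
    ext a
    rw [Finset.prod_apply]
    by_cases ha : a = 0
    · subst ha
      rw [Finset.prod_congr rfl (g := fun i => (d i)⁻¹)]
      · rw [Finset.prod_inv_distrib]
        exact inv_eq_of_mul_eq_one_left h0
      · intro i hi
        have := Finset.ne_of_mem_erase hi
        simp [Pi.mulSingle_apply, this.symm]
    · rw [Finset.prod_eq_single a]
      · simp [Pi.mulSingle_apply, ha]
      · intro b hb hba
        simp [Pi.mulSingle_apply, ha, hba.symm]
      · intro h
        exact absurd (Finset.mem_erase.2 ⟨ha, Finset.mem_univ _⟩) h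
  rw [heq] at hK
  exact hK

theorem det_one_mem_closure (S : Subring ℝ) (hS : Dense (S : Set ℝ)) {n : ℕ}
    (M : Matrix (Fin n) (Fin n) ℝ) (hM : M.det = 1) :
    M ∈ (slSub S n).topologicalClosure := by
  obtain ⟨L, L', d, h⟩ := Matrix.Pivot.exists_list_transvec_mul_diagonal_mul_list_transvec M
  have hl : ∀ L : List (Matrix.TransvectionStruct (Fin n) ℝ),
      (L.map Matrix.TransvectionStruct.toMatrix).prod ∈ (slSub S n).topologicalClosure := by
    intro L
    refine Submonoid.list_prod_mem _ fun x hx => ?_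
    obtain ⟨t, -, rfl⟩ := List.mem_map.1 hx
    exact transvection_mem_closure S hS t.i t.j t.hij t.c
  have hd : ∏ i, d i = 1 := by
    rw [h, Matrix.det_mul, Matrix.det_mul, Matrix.TransvectionStruct.det_toMatrix_prod,
      Matrix.TransvectionStruct.det_toMatrix_prod, Matrix.det_diagonal] at hM
    simpa using hM
  rw [h]
  exact mul_mem (mul_mem (hl L) (diagonal_mem_closure S hS d hd)) (hl L')

open scoped MatrixOrder ComplexOrder in
theorem exists_pos_conj_small {n : ℕ} (C : Matrix (Fin n) (Fin n) ℝ) (hC : IsNilpotent C) :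
    ∃ A : Matrix (Fin n) (Fin n) ℝ, 0 < A.det ∧ ∀ i j, |(A * C * A⁻¹) i j| ≤ 1 := by
  obtain ⟨m, hm⟩ := hC
  set P : Matrix (Fin n) (Fin n) ℝ := ∑ k ∈ Finset.range m, (C ^ k).conjTranspose * C ^ k with hP
  have h1 : C.conjTranspose * P * C + 1 = P := by
    have e1 := Finset.sum_range_succ' (fun k => (C ^ k).conjTranspose * C ^ k) m
    have e2 := Finset.sum_range_succ (fun k => (C ^ k).conjTranspose * C ^ k) m
    rw [hm, mul_zero, add_zero] at e2
    have e3 : P = _ := hP.trans (e2.symm.trans e1)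
    have e4 : C.conjTranspose * P * C =
        ∑ k ∈ Finset.range m, (C ^ (k + 1)).conjTranspose * C ^ (k + 1) := by
      rw [hP, Finset.mul_sum, Finset.sum_mul]
      simp [pow_succ, Matrix.conjTranspose_mul, mul_assoc]
    rw [e4]
    conv_rhs => rw [e3]
    simp
  have hPs : P.PosSemidef :=
    Matrix.posSemidef_sum _ fun k _ => Matrix.posSemidef_conjTranspose_mul_self _
  have hPd : P.PosDef := by
    rw [← h1]
    exact Matrix.PosDef.posSemidef_add (hPs.conjTranspose_mul_mul_same C) Matrix.PosDef.one
  obtain ⟨A, hA, hPA⟩ :=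
    CStarAlgebra.isStrictlyPositive_iff_exists_isStrictlyPositive_and_eq_mul_self.1
      hPd.isStrictlyPositive
  have hAd : A.PosDef := Matrix.isStrictlyPositive_iff_posDef.1 hA
  have hdet : 0 < A.det := hAd.det_pos
  have hAH : A.conjTranspose = A := hAd.1
  have hu : IsUnit A.det := hdet.ne'.isUnit
  refine ⟨A, hdet, fun i j => ?_⟩
  have hAiH : (A⁻¹).conjTranspose = A⁻¹ := by rw [Matrix.conjTranspose_nonsing_inv, hAH]
  have h2 : (A * C * A⁻¹).conjTranspose * (A * C * A⁻¹) =
      1 - (A⁻¹).conjTranspose * A⁻¹ := by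
    have e : C.conjTranspose * (A * A) * C = A * A - 1 := by
      rw [← hPA]; exact eq_sub_of_add_eq h1
    calc _ = A⁻¹ * (C.conjTranspose * (A * A) * C) * A⁻¹ := by
          simp only [Matrix.conjTranspose_mul, hAH, hAiH, mul_assoc]
      _ = (A⁻¹ * A) * (A * A⁻¹) - A⁻¹ * A⁻¹ := by rw [e]; noncomm_ring
      _ = _ := by rw [Matrix.nonsing_inv_mul _ hu, Matrix.mul_nonsing_inv _ hu, hAiH, one_mul]
  have h3 := congrFun (congrFun h2 j) j
  simp only [Matrix.mul_apply (M := (A * C * A⁻¹).conjTranspose), Matrix.sub_apply,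
    Matrix.mul_apply (M := (A⁻¹).conjTranspose),
    Matrix.conjTranspose_apply, star_trivial, Matrix.one_apply_eq] at h3
  have h4 : (A * C * A⁻¹) i j * (A * C * A⁻¹) i j ≤
      ∑ k, (A * C * A⁻¹) k j * (A * C * A⁻¹) k j :=
    Finset.single_le_sum (f := fun k => (A * C * A⁻¹) k j * (A * C * A⁻¹) k j)
      (fun k _ => mul_self_nonneg _) (Finset.mem_univ i)
  have h5 : 0 ≤ ∑ k, A⁻¹ k j * A⁻¹ k j := Finset.sum_nonneg fun k _ => mul_self_nonneg _
  rw [← sq_le_one_iff_abs_le_one]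
  nlinarith

theorem exists_real_SL_conj_small {n : ℕ} (N : Matrix (Fin n) (Fin n) ℝ)
    (hnil : IsNilpotent N) {δ : ℝ} (hδ : 0 < δ) :
    ∃ V : Matrix (Fin n) (Fin n) ℝ, V.det = 1 ∧ ∀ i j, |(V.adjugate * N * V) i j| ≤ δ := by
  rcases n with _ | n
  · exact ⟨1, by simp, fun i => i.elim0⟩
  obtain ⟨A, hA, hs⟩ := exists_pos_conj_small (δ⁻¹ • N) (hnil.smul δ⁻¹)
  set c : ℝ := A.det ^ ((1 : ℝ) / ((n + 1 : ℕ) : ℝ)) with hc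
  have hcpos : 0 < c := Real.rpow_pos_of_pos hA _
  have hcn : c ^ (n + 1) = A.det := by
    rw [hc, one_div]
    exact Real.rpow_inv_natCast_pow hA.le (by omega)
  have hu : IsUnit A.det := hA.ne'.isUnit
  have hdet : (c • A⁻¹).det = 1 := by
    rw [Matrix.det_smul, Fintype.card_fin, hcn, ← Matrix.det_mul, Matrix.mul_nonsing_inv _ hu,
      Matrix.det_one]
  have hadj : (c • A⁻¹).adjugate = c⁻¹ • A := by
    have e1 : (c • A⁻¹)⁻¹ = (c • A⁻¹).adjugate := by
      rw [Matrix.inv_def, hdet]; simp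
    rw [← e1]
    apply Matrix.inv_eq_left_inv
    rw [Matrix.smul_mul, Matrix.mul_smul, smul_smul, Matrix.mul_nonsing_inv _ hu,
      inv_mul_cancel₀ hcpos.ne', one_smul]
  refine ⟨c • A⁻¹, hdet, fun i j => ?_⟩
  have e : (c • A⁻¹).adjugate * N * (c • A⁻¹) = δ • (A * (δ⁻¹ • N) * A⁻¹) := by
    rw [hadj]
    simp only [Matrix.smul_mul, Matrix.mul_smul, smul_smul]
    rw [mul_inv_cancel₀ hδ.ne', mul_inv_cancel₀ hcpos.ne']
  rw [e, Matrix.smul_apply, smul_eq_mul, abs_mul, abs_of_pos hδ]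
  nlinarith [hs i j]

/-- If `R` is a dense subring of `ℝ`, `N` is a nilpotent `n × n` matrix over `R`
and `δ > 0`, then there is `V ∈ SL(n, R)` with `‖V⁻¹ N V‖∞ < δ`. -/
theorem exists_SL_conj_small_of_nilpotent (S : Subring ℝ) (hS : Dense (S : Set ℝ))
    {n : ℕ} (N : Matrix (Fin n) (Fin n) ℝ) (hN : ∀ i j, N i j ∈ S)
    (hnil : IsNilpotent N) {δ : ℝ} (hδ : 0 < δ) :
    ∃ V : Matrix (Fin n) (Fin n) ℝ,
      (∀ i j, V i j ∈ S) ∧ V.det = 1 ∧ matNormInf (V⁻¹ * N * V) < δ := by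
  obtain ⟨V₀, hV₀, hb⟩ := exists_real_SL_conj_small N hnil (δ := δ / 4) (by positivity)
  have hcl : V₀ ∈ closure (slSub S n : Set (Matrix (Fin n) (Fin n) ℝ)) :=
    det_one_mem_closure S hS V₀ hV₀
  have hopen : IsOpen {V : Matrix (Fin n) (Fin n) ℝ |
      ∀ i j, |(V.adjugate * N * V) i j| < δ / 2} := by
    simp only [Set.ofPred_forall]
    refine isOpen_iInter_of_finite fun i => isOpen_iInter_of_finite fun j => ?_
    refine isOpen_lt ?_ continuous_const
    have hcont : Continuous fun V : Matrix (Fin n) (Fin n) ℝ => V.adjugate * N * V :=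
      ((continuous_id.matrix_adjugate).mul continuous_const).mul continuous_id
    exact (hcont.matrix_elem i j).abs
  obtain ⟨V, hV, hVS, hVd⟩ := mem_closure_iff.1 hcl _ hopen
    (fun i j => (hb i j).trans_lt (by linarith))
  refine ⟨V, hVS, hVd, ?_⟩
  have e1 : V⁻¹ = V.adjugate := by
    rw [Matrix.inv_def, hVd]; simp
  rw [e1]
  refine lt_of_le_of_lt (b := δ / 2) ?_ (by linarith)
  unfold matNormInf
  exact Real.iSup_le (fun i => Real.iSup_le (fun j => (hV i j).le) (by positivity)) (by positivity)
end

section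
/- Let N be a nilpotent n×n real matrix and let γ > 0. Then there exists a matrix U in SL(n, ℝ) such that U⁻¹ N U = γ·N. -/
open NormedSpace in
/-- If `N H = (H + 1) N`, then `N exp(tH) = e^t exp(tH) N`. -/
theorem nilp_exp_conj {n : ℕ} (N H : Matrix (Fin n) (Fin n) ℝ) (t : ℝ)
    (h : N * H = (H + 1) * N) :
    N * exp (t • H) = Real.exp t • (exp (t • H) * N) := by
  have hs : SemiconjBy N (t • H) (t • H + algebraMap ℝ _ t) := by
    unfold SemiconjBy
    rw [Algebra.algebraMap_eq_smul_one, ← smul_add, mul_smul_comm, smul_mul_assoc, h]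
  have h2 : N * exp (t • H) = exp (t • H + algebraMap ℝ _ t) * N := by
    open scoped Matrix.Norms.Operator in exact hs.exp_right
  have h3 : exp (algebraMap ℝ (Matrix (Fin n) (Fin n) ℝ) t) = algebraMap ℝ _ (exp t) := by
    open scoped Matrix.Norms.Operator in exact (algebraMap_exp_comm t).symm
  rw [h2, Matrix.exp_add_of_commute _ _ (Algebra.commutes t (t • H)).symm, h3,
    ← Real.exp_eq_exp_ℝ, Algebra.algebraMap_eq_smul_one]
  simp

/-- A nilpotent `N` lies in the image of `ad N`. -/
theorem nilp_exists_grading {n : ℕ} (N : Matrix (Fin n) (Fin n) ℝ) (hnil : IsNilpotent N) :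
    ∃ H : Matrix (Fin n) (Fin n) ℝ, N * H - H * N = N := by
  let L : Matrix (Fin n) (Fin n) ℝ →ₗ[ℝ] Matrix (Fin n) (Fin n) ℝ :=
    LinearMap.mulLeft ℝ N - LinearMap.mulRight ℝ N
  by_contra hcon
  have hN : N ∉ LinearMap.range L := by
    rintro ⟨H, hH⟩
    exact hcon ⟨H, by simpa [L] using hH⟩
  obtain ⟨f, hf, hf'⟩ := Submodule.exists_dual_map_eq_bot_of_notMem hN inferInstance
  have hfL : ∀ X, f (N * X - X * N) = 0 := by
    intro X
    have : f (L X) ∈ (LinearMap.range L).map f := ⟨L X, ⟨X, rfl⟩, rfl⟩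
    rw [hf'] at this
    simpa [L] using this
  let Z : Matrix (Fin n) (Fin n) ℝ := Matrix.of fun i j => f (Matrix.single j i 1)
  have hZ : ∀ X, f X = (Z * X).trace := by
    intro X
    conv_lhs => rw [Matrix.matrix_eq_sum_single X]
    simp only [map_sum, Matrix.trace, Matrix.diag, Matrix.mul_apply]
    rw [Finset.sum_comm]
    refine Finset.sum_congr rfl fun i _ => Finset.sum_congr rfl fun j _ => ?_
    have : Matrix.single j i (X j i) = X j i • Matrix.single j i (1 : ℝ) := by simp
    rw [this, map_smul]
    simp [Z, mul_comm]
  have hcomm : Z * N = N * Z := by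
    rw [Matrix.ext_iff_trace_mul_right]
    intro X
    have h := hfL X
    rw [hZ, mul_sub, Matrix.trace_sub, sub_eq_zero] at h
    rw [mul_assoc, h, ← mul_assoc, Matrix.trace_mul_comm, ← mul_assoc]
  apply hf
  rw [hZ]
  have hc : Commute Z N := hcomm
  exact (Matrix.isNilpotent_trace_of_isNilpotent (hc.isNilpotent_mul_left hnil)).eq_zero

/-- If `N` is a nilpotent real `n × n` matrix and `γ > 0`, then there is
`U ∈ SL(n, ℝ)` with `U⁻¹ * N * U = γ • N`. -/
theorem exists_SL_conj_smul_of_nilpotent {n : ℕ} (N : Matrix (Fin n) (Fin n) ℝ)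
    (hnil : IsNilpotent N) {γ : ℝ} (hγ : 0 < γ) :
    ∃ U : Matrix (Fin n) (Fin n) ℝ, U.det = 1 ∧ U⁻¹ * N * U = γ • N := by
  obtain ⟨H, hH⟩ := nilp_exists_grading N hnil
  have h1 : N * H = (H + 1) * N := by
    rw [add_mul, one_mul, ← sub_eq_iff_eq_add', hH]
  have h2 := nilp_exp_conj N H (Real.log γ) h1
  rw [Real.exp_log hγ] at h2
  set V := NormedSpace.exp (Real.log γ • H) with hV
  have hdet : 0 < V.det := by
    have hsq : V = NormedSpace.exp ((Real.log γ / 2) • H) ^ 2 := by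
      rw [← Matrix.exp_nsmul, hV]
      congr 1
      rw [← Nat.cast_smul_eq_nsmul ℝ, smul_smul]
      congr 1
      push_cast
      ring
    have hu := (Matrix.isUnit_iff_isUnit_det _).1 (Matrix.isUnit_exp ((Real.log γ / 2) • H))
    rw [hsq, Matrix.det_pow]
    have := hu.ne_zero
    positivity
  obtain ⟨c, hc⟩ : ∃ c : ℝ, c ^ n * V.det = 1 := by
    rcases Nat.eq_zero_or_pos n with rfl | hn
    · exact ⟨1, by simp⟩
    · refine ⟨(V.det⁻¹) ^ ((n : ℝ)⁻¹), ?_⟩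
      rw [Real.rpow_inv_natCast_pow (by positivity) hn.ne']
      exact inv_mul_cancel₀ hdet.ne'
  have hd : (c • V).det = 1 := by simpa [Matrix.det_smul] using hc
  refine ⟨c • V, hd, ?_⟩
  have h3 : N * (c • V) = (c • V) * (γ • N) := by
    rw [mul_smul_comm, h2, smul_mul_assoc, mul_smul_comm]
  rw [mul_assoc, h3, ← mul_assoc, Matrix.nonsing_inv_mul _ (by rw [hd]; exact isUnit_one), one_mul]
end

section
/- Let R be a commutative ring, let C and M be n×n matrices over R, and let ε ∈ R. Then the 2n×2n block matrix G = [[(1−ε)C + εM, ε(C − M)], [(1−ε)(C − M), εC + (1−ε)M]] is conjugate over R to the block diagonal matrix [[C, 0], [0, M]]; explicitly, G = P⁻¹ Q⁻¹ [[C,0],[0,M]] Q P where Q = [[I, εI],[0, I]] and P = [[I, 0],[−I, I]] (with I the n×n identity), and Q, P lie in SL(2n, R). In particular G is strong shift equivalent over R to [[C, 0], [0, M]]. -/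
/-- The `(n+n) × (n+n)` matrix built from four `n × n` blocks. -/
def blk {R : Type*} [Semiring R] {n : ℕ} (A B C D : Matrix (Fin n) (Fin n) R) :
    Matrix (Fin (n + n)) (Fin (n + n)) R :=
  Matrix.reindex finSumFinEquiv finSumFinEquiv (Matrix.fromBlocks A B C D)

/-- Over a commutative ring `R`, the block matrix
`G = [[(1−ε)C + εM, ε(C − M)], [(1−ε)(C − M), εC + (1−ε)M]]` equals
`P⁻¹ Q⁻¹ [[C,0],[0,M]] Q P` where `Q = [[I, εI],[0,I]]` and `P = [[I,0],[−I,I]]`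
lie in `SL(2n, R)`; in particular `G` is strong shift equivalent over `R`
to the block diagonal matrix `[[C,0],[0,M]]`. -/
theorem block_mix_conjugate_blockDiag {R : Type*} [CommRing R] {n : ℕ}
    (C M : Matrix (Fin n) (Fin n) R) (ε : R) :
    (blk (1 : Matrix (Fin n) (Fin n) R) (ε • 1) 0 1).det = 1 ∧
    (blk (1 : Matrix (Fin n) (Fin n) R) 0 (-1) 1).det = 1 ∧
    blk ((1 - ε) • C + ε • M) (ε • (C - M)) ((1 - ε) • (C - M)) (ε • C + (1 - ε) • M) =
      (blk (1 : Matrix (Fin n) (Fin n) R) 0 (-1) 1)⁻¹ *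
        (blk (1 : Matrix (Fin n) (Fin n) R) (ε • 1) 0 1)⁻¹ *
        blk C 0 0 M *
        blk (1 : Matrix (Fin n) (Fin n) R) (ε • 1) 0 1 *
        blk (1 : Matrix (Fin n) (Fin n) R) 0 (-1) 1 ∧
    IsSSE (Set.univ : Set R)
      (blk ((1 - ε) • C + ε • M) (ε • (C - M)) ((1 - ε) • (C - M)) (ε • C + (1 - ε) • M))
      (blk C 0 0 M) := by
  have hmul : ∀ A B C D A₂ B₂ C₂ D₂ : Matrix (Fin n) (Fin n) R,
      blk A B C D * blk A₂ B₂ C₂ D₂ =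
        blk (A * A₂ + B * C₂) (A * B₂ + B * D₂) (C * A₂ + D * C₂) (C * B₂ + D * D₂) := by
    intro A B C D A₂ B₂ C₂ D₂
    simp only [blk, Matrix.reindex_apply, Matrix.submatrix_mul_equiv, Matrix.fromBlocks_multiply]
  have hone : blk (1 : Matrix (Fin n) (Fin n) R) 0 0 1 = 1 := by
    simp [blk]
  have hQ : (blk (1 : Matrix (Fin n) (Fin n) R) (ε • 1) 0 1)⁻¹ = blk 1 (-(ε • 1)) 0 1 := by
    apply Matrix.inv_eq_right_inv
    rw [hmul, ← hone]
    simp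
  have hP : (blk (1 : Matrix (Fin n) (Fin n) R) 0 (-1) 1)⁻¹ = blk 1 0 1 1 := by
    apply Matrix.inv_eq_right_inv
    rw [hmul, ← hone]
    simp
  have hG : blk ((1 - ε) • C + ε • M) (ε • (C - M)) ((1 - ε) • (C - M))
      (ε • C + (1 - ε) • M) =
      blk 1 0 1 1 * blk 1 (-(ε • 1)) 0 1 * blk C 0 0 M * blk 1 (ε • 1) 0 1 *
        blk 1 0 (-1) 1 := by
    simp only [hmul]
    congr 1 <;> simp [add_mul, mul_add] <;> module
  refine ⟨?_, ?_, ?_, ?_⟩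
  · simp [blk]
  · simp [blk]
  · rw [hQ, hP, hG]
  · refine Relation.TransGen.single ⟨blk 1 0 1 1 * blk 1 (-(ε • 1)) 0 1 * blk C 0 0 M,
      blk 1 (ε • 1) 0 1 * blk 1 0 (-1) 1, fun _ _ => trivial, fun _ _ => trivial, ?_, ?_⟩
    · simp only [hG, Matrix.mul_assoc]
    · simp only [hmul]
      congr 1 <;> simp [add_mul, mul_add] <;> module
end

section
/- Let A be a square matrix with nonnegative integer entries. Then for every positive integer n, the n-th net trace Σ_{d | n} μ(n/d)·trace(A^d) is nonnegative, where the sum is over positive divisors d of n and μ is the Möbius function. -/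
namespace NetTrace

/-- Path expansion of the entries of a matrix power. -/
lemma pow_entry {ι : Type*} [Fintype ι] [DecidableEq ι] (B : Matrix ι ι ℤ) (n : ℕ) :
    ∀ i j, (B ^ n) i j = ∑ x : Fin (n + 1) → ι,
      if x 0 = i ∧ x (Fin.last n) = j then ∏ k : Fin n, B (x k.castSucc) (x k.succ) else 0 := by
  induction n with
  | zero =>
    intro i j
    rw [← (Equiv.funUnique (Fin 1) ι).symm.sum_comp]
    simp only [pow_zero, Matrix.one_apply]
    simp [ite_and]
  | succ n ih =>
    intro i j
    rw [pow_succ', Matrix.mul_apply]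
    simp only [ih]
    rw [← (Fin.consEquiv (fun _ : Fin (n + 2) => ι)).sum_comp, Fintype.sum_prod_type]
    simp only [Finset.mul_sum]
    rw [Finset.sum_comm]
    rw [Finset.sum_comm (γ := ι)]
    refine Finset.sum_congr rfl fun x _ => ?_
    simp only [Fin.consEquiv, Equiv.coe_fn_mk, Fin.cons_zero, Fin.prod_univ_succ (n := n),
      ← Fin.succ_last, Fin.cons_succ, Fin.castSucc_zero, ← Fin.succ_castSucc]
    by_cases h : x (Fin.last n) = j
    · simp [h]
    · simp [h]

variable {E : Type*}

/-- One-sided infinite paths. -/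
def X (r : E → E → Prop) := {x : ℕ → E // ∀ k, r (x k) (x (k + 1))}

/-- The shift. -/
def T (r : E → E → Prop) (x : X r) : X r := ⟨fun k => x.1 (k + 1), fun k => x.2 (k + 1)⟩

lemma T_iter (r : E → E → Prop) (n : ℕ) (x : X r) (k : ℕ) :
    ((T r)^[n] x).1 k = x.1 (k + n) := by
  induction n generalizing k with
  | zero => rfl
  | succ n ih =>
    rw [Function.iterate_succ_apply']
    change ((T r)^[n] x).1 (k + 1) = _
    rw [ih, Nat.add_assoc, Nat.add_comm 1 n]

lemma periodic_iff (r : E → E → Prop) (n : ℕ) (x : X r) :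
    Function.IsPeriodicPt (T r) n x ↔ Function.Periodic x.1 n := by
  constructor
  · intro h k
    rw [← T_iter]; rw [h]
  · intro h
    apply Subtype.ext
    funext k
    rw [T_iter]; exact h k

/-- Periodic points of the shift correspond to closed walks. -/
def perEquiv (r : E → E → Prop) (n : ℕ) (hn : 0 < n) :
    {x : X r // Function.IsPeriodicPt (T r) n x} ≃
    {x : Fin (n + 1) → E // x 0 = x (Fin.last n) ∧ ∀ k : Fin n, r (x k.castSucc) (x k.succ)} where
  toFun x := ⟨fun k => x.1.1 k, by
    have := (periodic_iff r n x.1).1 x.2 0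
    simpa using this.symm, fun k => by simpa using x.1.2 k⟩
  invFun y := ⟨⟨fun k => y.1 ⟨k % n, (Nat.mod_lt k hn).trans (Nat.lt_succ_self n)⟩, fun k => by
      have h := y.2.2 ⟨k % n, Nat.mod_lt k hn⟩
      have hlt := Nat.mod_lt k hn
      have key : y.1 ⟨(k + 1) % n, (Nat.mod_lt _ hn).trans (Nat.lt_succ_self n)⟩ =
          y.1 (Fin.succ ⟨k % n, Nat.mod_lt k hn⟩) := by
        by_cases hk : k % n + 1 = n
        · have h0 : (k + 1) % n = 0 := by
            rw [← Nat.mod_add_mod, hk, Nat.mod_self]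
          have e1 : (⟨(k + 1) % n, (Nat.mod_lt _ hn).trans (Nat.lt_succ_self n)⟩ : Fin (n+1)) = 0 :=
            Fin.ext (by simp [h0])
          have e2 : (Fin.succ ⟨k % n, Nat.mod_lt k hn⟩ : Fin (n+1)) = Fin.last n :=
            Fin.ext (by simp [hk])
          rw [e1, e2, y.2.1]
        · refine congrArg y.1 (Fin.ext ?_)
          simp only [Fin.succ_mk]
          rw [← Nat.mod_add_mod, Nat.mod_eq_of_lt]; omega
      change r _ (y.1 ⟨(k + 1) % n, _⟩)
      rw [key]; exact h⟩, (periodic_iff r n _).2 fun k => by simp⟩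
  left_inv x := by
    apply Subtype.ext; apply Subtype.ext; funext k
    exact ((periodic_iff r n x.1).1 x.2).map_mod_nat k
  right_inv y := by
    apply Subtype.ext; funext k
    rcases Fin.eq_castSucc_or_eq_last k with ⟨k, rfl⟩ | rfl
    · refine congrArg y.1 (Fin.ext ?_)
      simp [Nat.mod_eq_of_lt k.2]
    · simp only [Fin.val_last, Nat.mod_self]
      exact y.2.1

lemma trace_eq [Fintype E] [DecidableEq E] (r : E → E → Prop) [DecidableRel r] (n : ℕ)
    (hn : 0 < n) :
    ((Matrix.of fun e f => if r e f then (1 : ℤ) else 0) ^ n).trace =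
      Nat.card {x : X r // Function.IsPeriodicPt (T r) n x} := by
  rw [Nat.card_congr (perEquiv r n hn), Nat.card_eq_fintype_card, Fintype.card_subtype]
  simp only [Matrix.trace, Matrix.diag, pow_entry]
  rw [Finset.sum_comm, Finset.card_filter]
  push_cast
  refine Finset.sum_congr rfl fun x _ => ?_
  simp only [Matrix.of_apply, Finset.prod_ite_zero, Finset.prod_const_one, ite_and,
    Finset.sum_ite_eq, Finset.mem_univ, if_true, true_implies]
  simp [eq_comm]

lemma card_eq_sum [Finite E] (r : E → E → Prop) (n : ℕ) (hn : 0 < n) :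
    Nat.card {x : X r // Function.IsPeriodicPt (T r) n x} =
      ∑ d ∈ n.divisors, Nat.card {x : X r // Function.minimalPeriod (T r) x = d} := by
  classical
  have := Fintype.ofFinite E
  have hF : Finite {x : X r // Function.IsPeriodicPt (T r) n x} :=
    Finite.of_equiv _ (perEquiv r n hn).symm
  let e : {x : X r // Function.IsPeriodicPt (T r) n x} ≃
      Σ d : n.divisors, {x : X r // Function.minimalPeriod (T r) x = d} :=
    { toFun := fun x => ⟨⟨Function.minimalPeriod (T r) x.1,
        Nat.mem_divisors.2 ⟨x.2.minimalPeriod_dvd, hn.ne'⟩⟩, ⟨x.1, rfl⟩⟩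
      invFun := fun y => ⟨y.2.1, (Function.isPeriodicPt_iff_minimalPeriod_dvd).2 (by
        rw [y.2.2]; exact Nat.dvd_of_mem_divisors y.1.2)⟩
      left_inv := fun x => rfl
      right_inv := by
        rintro ⟨⟨d, hd⟩, ⟨x, hx⟩⟩
        change Function.minimalPeriod (T r) x = d at hx
        subst hx
        rfl }
  have hS := Finite.of_equiv _ e
  have hS' : ∀ d : n.divisors, Finite {x : X r // Function.minimalPeriod (T r) x = d} := fun d =>
    Finite.of_injective (fun x => (⟨d, x⟩ :
      Σ d : n.divisors, {x : X r // Function.minimalPeriod (T r) x = d}))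
      (fun a b h => eq_of_heq (Sigma.mk.inj h).2)
  rw [Nat.card_congr e, Nat.card_sigma]
  exact Finset.sum_coe_sort n.divisors
    (fun d => Nat.card {x : X r // Function.minimalPeriod (T r) x = d})

end NetTrace

open ArithmeticFunction in
/-- For a square matrix `A` with nonnegative integer entries, every net trace
`∑_{d ∣ n} μ(n/d) * trace (A ^ d)` is nonnegative. -/
theorem net_trace_nonneg {m : ℕ} (A : Matrix (Fin m) (Fin m) ℤ)
    (hA : ∀ i j, 0 ≤ A i j) (n : ℕ) (hn : 0 < n) :
    0 ≤ ∑ d ∈ n.divisors, (moebius (n / d) : ℤ) * (A ^ d).trace := by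
  classical
  let E := Σ p : Fin m × Fin m, Fin (A p.1 p.2).toNat
  let r : E → E → Prop := fun e f => e.1.2 = f.1.1
  let P : Matrix (Fin m) E ℤ := Matrix.of fun i e => if e.1.1 = i then 1 else 0
  let Q : Matrix E (Fin m) ℤ := Matrix.of fun e j => if e.1.2 = j then 1 else 0
  have hPQ : A = P * Q := by
    ext i j
    rw [Matrix.mul_apply, Fintype.sum_sigma, Fintype.sum_prod_type]
    have h : ∀ a b : Fin m, (∑ y : Fin (A a b).toNat, P i ⟨(a, b), y⟩ * Q ⟨(a, b), y⟩ j) =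
        if a = i then (if b = j then A a b else 0) else 0 := by
      intro a b
      change (∑ y : Fin (A a b).toNat, (if a = i then (1 : ℤ) else 0) * (if b = j then 1 else 0)) = _
      rw [Finset.sum_const, Finset.card_univ, Fintype.card_fin]
      by_cases h1 : a = i <;> by_cases h2 : b = j <;> simp [h1, h2, hA]
    refine Eq.trans ?_ (Finset.sum_congr rfl fun a _ => Finset.sum_congr rfl fun b _ => h a b).symm
    simp
  have hQP : Q * P = Matrix.of fun e f => if r e f then (1 : ℤ) else 0 := by
    ext e f
    simp [Matrix.mul_apply, P, Q, r, eq_comm]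
  have hpow : ∀ k : ℕ, (P * Q) ^ (k + 1) = P * ((Q * P) ^ k * Q) := by
    intro k
    induction k with
    | zero => simp
    | succ k ih => rw [pow_succ', ih, pow_succ' (Q * P)]; simp only [Matrix.mul_assoc]
  have htr : ∀ d : ℕ, 0 < d → (A ^ d).trace =
      Nat.card {x : NetTrace.X r // Function.IsPeriodicPt (NetTrace.T r) d x} := by
    intro d hd
    rw [← NetTrace.trace_eq r d hd, ← hQP]
    obtain ⟨k, rfl⟩ : ∃ k, d = k + 1 := ⟨d - 1, by omega⟩
    rw [show A ^ (k + 1) = (P * Q) ^ (k + 1) from congrArg (· ^ (k + 1)) hPQ]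
    rw [hpow, Matrix.trace_mul_comm, pow_succ, Matrix.mul_assoc]
  have key := (sum_eq_iff_sum_mul_moebius_eq
    (f := fun d => (Nat.card {x : NetTrace.X r // Function.minimalPeriod (NetTrace.T r) x = d} : ℤ))
    (g := fun d => (A ^ d).trace)).1 (fun d hd => by
      rw [htr d hd, NetTrace.card_eq_sum r d hd]; push_cast; rfl) n hn
  have key2 : ∑ d ∈ n.divisors, (moebius (n / d) : ℤ) * (A ^ d).trace =
      (Nat.card {x : NetTrace.X r // Function.minimalPeriod (NetTrace.T r) x = n} : ℤ) := by
    rw [← key, ← Nat.map_div_left_divisors, Finset.sum_map]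
    rfl
  rw [key2]
  positivity
end
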